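/- arXiv:1306.5882 — 3 statements merged into one kernel-verified Lean document; each statement's English description precedes it below -/
import Mathlib

section
/- Let s ≥ 0 and let A_1, A_2, B_1, B_2 be β-sets of cardinality s. Suppose X_1 and X_2 are β-sets of cardinality s with rk(X_i) = rk(A_i) + rk(B_i) and X_i ⊴ A_i⊙B_i for i = 1, 2. Then for each of the maps Δ ∈ {Δ_B^t (t ≥ 0), Δ_C^t (t ≥ 0), Δ_{C'}^t (t ≥ 1), Δ_D^t (t ≥ 1), Δ_D^0} one has b(Δ(A_1⊙B_1, A_2⊙B_2)) ≤ b(Δ(X_1, X_2)), with equality if and only if X_1 = A_1⊙B_1 and X_2 = A_2⊙B_2. -/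
namespace CSpaper

/-- The rank of a β-set: the sum of its elements minus `choose (card) 2`. -/
def bRank (B : Finset ℕ) : ℤ :=
  (∑ b ∈ B, (b : ℤ)) - (B.card.choose 2 : ℤ)

/-- The `k`-th shift of a β-set: `{0,…,k-1} ∪ {b+k : b ∈ B}`. -/
def bShift (k : ℕ) (B : Finset ℕ) : Finset ℕ :=
  Finset.range k ∪ B.image (· + k)

/-- Shift-equivalence of β-sets. -/
def sEquiv (A B : Finset ℕ) : Prop :=
  ∃ k, bShift k A = B ∨ A = bShift k B

/-- A β-pair: an ordered pair of β-sets. -/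
abbrev BPair := Finset ℕ × Finset ℕ

/-- The defect of a β-pair. -/
def pDefect (Λ : BPair) : ℤ := (Λ.1.card : ℤ) - (Λ.2.card : ℤ)

/-- The rank of a β-pair: `rk A + rk B + ⌊(d/2)²⌋`. -/
def pRank (Λ : BPair) : ℤ := bRank Λ.1 + bRank Λ.2 + pDefect Λ ^ 2 / 4

/-- The `k`-th shift of a β-pair. -/
def pShift (k : ℕ) (Λ : BPair) : BPair := (bShift k Λ.1, bShift k Λ.2)

/-- Shift-equivalence of β-pairs: one is a shift of the other. -/
def pEquiv (Λ Ξ : BPair) : Prop := ∃ k, pShift k Λ = Ξ ∨ Λ = pShift k Ξ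

/-- `Λ` is a representative of a symbol in `𝕍_N^d`. -/
def inV (N d : ℤ) (Λ : BPair) : Prop := pRank Λ = N ∧ pDefect Λ = d

/-- The `i`-th smallest element of a finite set of naturals (0-indexed). -/
def nthEl (A : Finset ℕ) (i : ℕ) : ℕ := (A.sort (· ≤ ·)).getD i 0

/-- The operation `A ⊙ B = {a_1+b_1, a_2+b_2-1, …, a_s+b_s-(s-1)}` (0-indexed:
`a_i + b_i - i`). -/
def odot (A B : Finset ℕ) : Finset ℕ :=
  (Finset.range A.card).image fun i => nthEl A i + nthEl B i - i

/-- Dominance order `B ⊴ A`: every tail sum of `B` is at most the corresponding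
tail sum of `A`. -/
def domLE (B A : Finset ℕ) : Prop :=
  ∀ k, ∑ i ∈ Finset.Ico k B.card, nthEl B i ≤ ∑ i ∈ Finset.Ico k A.card, nthEl A i

/-- No two consecutive integers. -/
def noConsec (S : Finset ℕ) : Prop := ∀ x ∈ S, x + 1 ∉ S

/-- `{0,2,…,2k-2} ∪ {x+2k : x ∈ S}`. -/
def evShift (k : ℕ) (S : Finset ℕ) : Finset ℕ :=
  (Finset.range k).image (fun i => 2 * i) ∪ S.image (· + 2 * k)

/-- `{1,3,…,2k-1} ∪ {y+2k : y ∈ S}`. -/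
def odShift (k : ℕ) (S : Finset ℕ) : Finset ℕ :=
  (Finset.range k).image (fun i => 2 * i + 1) ∪ S.image (· + 2 * k)

/-- The `k`-th shift in the 𝕐-family. -/
def yShift (k : ℕ) (P : BPair) : BPair := (evShift k P.1, odShift k P.2)

/-- The `k`-th shift in the 𝕏-family. -/
def xShift (k : ℕ) (P : BPair) : BPair := (evShift k P.1, evShift k P.2)

/-- Shift-equivalence in the 𝕐-family. -/
def yEquiv (P Q : BPair) : Prop := ∃ k, yShift k P = Q ∨ P = yShift k Q

/-- Shift-equivalence in the 𝕏-family (unordered pairs, so swaps are allowed). -/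
def xEquiv (P Q : BPair) : Prop :=
  ∃ k, xShift k P = Q ∨ xShift k P = Q.swap ∨ P = xShift k Q ∨ P.swap = xShift k Q

/-- Membership in `Ỹ_N`. -/
def inYtilde (N : ℤ) (P : BPair) : Prop :=
  (∀ y ∈ P.2, 0 < y) ∧ Odd (P.1.card + P.2.card) ∧ noConsec P.1 ∧ noConsec P.2 ∧
    2 * ((∑ x ∈ P.1, (x : ℤ)) + ∑ y ∈ P.2, (y : ℤ)) =
      N + ((P.1.card + P.2.card : ℕ) : ℤ) * (((P.1.card + P.2.card : ℕ) : ℤ) - 1)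

/-- The defect in the 𝕐-family: `|X| - |Y|`. -/
def yDefect (P : BPair) : ℤ := (P.1.card : ℤ) - (P.2.card : ℤ)

/-- Membership in `X̃_N`. -/
def inXtilde (N : ℤ) (P : BPair) : Prop :=
  noConsec P.1 ∧ noConsec P.2 ∧
    2 * ((∑ x ∈ P.1, (x : ℤ)) + ∑ y ∈ P.2, (y : ℤ)) =
      N + (((P.1.card + P.2.card : ℕ) : ℤ) - 1) ^ 2 - 1

/-- The defect in the 𝕏-family: `||A| - |B||`. -/
def xDefect (P : BPair) : ℤ := |(P.1.card : ℤ) - (P.2.card : ℤ)|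

/-- The map `Θ(A,B) = ({0, a_1+2, …, a_s+s+1}, {b_1+1, …, b_s+s})`. -/
def theta (Λ : BPair) : BPair :=
  (insert 0 ((Finset.range Λ.1.card).image fun i => nthEl Λ.1 i + i + 2),
   (Finset.range Λ.2.card).image fun i => nthEl Λ.2 i + i + 1)

/-- The map `Θ'(A,B) = ({0, a_1+2, …, a_s+s+1}, {b_1, …, b_s+s-1})`. -/
def theta' (Λ : BPair) : BPair :=
  (insert 0 ((Finset.range Λ.1.card).image fun i => nthEl Λ.1 i + i + 2),
   (Finset.range Λ.2.card).image fun i => nthEl Λ.2 i + i)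

/-- The map `Θ̄(A,B) = ({a_1, …, a_s+s-1}, {b_1, …, b_s+s-1})`. -/
def thetaBar (Λ : BPair) : BPair :=
  ((Finset.range Λ.1.card).image fun i => nthEl Λ.1 i + i,
   (Finset.range Λ.2.card).image fun i => nthEl Λ.2 i + i)

/-- `ᵀΘ(A,B) = Θ(B,A)`. -/
def thetaT (Λ : BPair) : BPair := theta (Λ.2, Λ.1)

/-- `Π^d` for `d ≥ 1`: adjoin `{0,2,…,2d-4}` to the first row and add `2d-2`
to its entries. -/
def piPos (d : ℕ) (P : BPair) : BPair := (evShift (d - 1) P.1, P.2)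

/-- `Π^d` for `d = -e ≤ -1`: adjoin `{1,3,…,2e+1}` to the second row and add
`2e+2` to its entries. -/
def piNeg (e : ℕ) (P : BPair) : BPair := (P.1, odShift (e + 1) P.2)

/-- `Δ_B^t = Π^{2t+1} ∘ Θ'`. -/
def deltaB (t : ℕ) (Λ : BPair) : BPair := piPos (2 * t + 1) (theta' Λ)

/-- `Δ_C^t = Π^{4t+1} ∘ Θ`. -/
def deltaC (t : ℕ) (Λ : BPair) : BPair := piPos (4 * t + 1) (theta Λ)

/-- `Δ_{C'}^t = Π^{1-4t} ∘ ᵀΘ` (for `t ≥ 1`). -/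
def deltaC' (t : ℕ) (Λ : BPair) : BPair := piNeg (4 * t - 1) (thetaT Λ)

/-- `Δ_D^t = Π^{4t} ∘ Θ'` (for `t ≥ 1`). -/
def deltaD (t : ℕ) (Λ : BPair) : BPair := piPos (4 * t) (theta' Λ)

/-- `Δ_D^0 = Θ̄`. -/
def deltaD0 (Λ : BPair) : BPair := thetaBar Λ

/-- All entries of a pair (with multiplicity) in weakly increasing order. -/
def entries (P : BPair) : List ℕ := (P.1.val + P.2.val).sort (· ≤ ·)

/-- `Σ_j (len-1-j) ⬝ (L[j] - ref j)`, the common shape of `a`, `b` and `σ`. -/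
def wsum (L : List ℕ) (ref : ℕ → ℕ) : ℤ :=
  ∑ j ∈ Finset.range L.length,
    ((L.length - 1 - j : ℕ) : ℤ) * ((L.getD j 0 : ℤ) - (ref j : ℤ))

/-- Lusztig's a-function (reference sequence `0,0,1,1,…`). -/
def aFun (P : BPair) : ℤ := wsum (entries P) (fun j => j / 2)

/-- Lusztig's b-function with the 𝕏-reference sequence `0,0,2,2,…`. -/
def bX (P : BPair) : ℤ := wsum (entries P) (fun j => 2 * (j / 2))

/-- Lusztig's b-function with the 𝕐-reference sequence `0,1,2,…`. -/
def bY (P : BPair) : ℤ := wsum (entries P) (fun j => j)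

/-- `σ(Λ) = Σ (2k-i)·x_i`. -/
def sigmaFun (P : BPair) : ℤ := wsum (entries P) (fun _ => 0)

/-- Entrywise sum of two rows (of equal size), sorted positions added. -/
def addRows (X X' : Finset ℕ) : Finset ℕ :=
  (Finset.range X.card).image fun i => nthEl X i + nthEl X' i

/-- `Λ ⊕ Ξ` in the types B and D cases. -/
def oplus (Λ Ξ : BPair) : BPair := (addRows Λ.1 Ξ.1, addRows Λ.2 Ξ.2)

/-- `Λ ⊕ Ξ` in the type C case. -/
def oplusC (Λ Ξ : BPair) : BPair :=
  (insert (nthEl Ξ.1 0)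
      ((Finset.range Λ.1.card).image fun i => nthEl Λ.1 i + nthEl Ξ.1 (i + 1) + 1),
   (Finset.range Λ.2.card).image fun j => nthEl Λ.2 j + nthEl Ξ.2 j + 1)

/-- `Λ ⊞ Ξ`: the twisted combination in type D. -/
def boxplus (Λ Ξ : BPair) : BPair := (addRows Λ.2 Ξ.1, addRows Λ.1 Ξ.2)

/-- Similarity of β-pairs: after shifts, the row unions and row intersections
coincide. -/
def pSimilar (Λ Ξ : BPair) : Prop :=
  ∃ j k, (pShift j Λ).1 ∪ (pShift j Λ).2 = (pShift k Ξ).1 ∪ (pShift k Ξ).2 ∧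
    (pShift j Λ).1 ∩ (pShift j Λ).2 = (pShift k Ξ).1 ∩ (pShift k Ξ).2

/-- Similarity in the 𝕏-family: after 𝕏-shifts, the row unions and
intersections coincide. -/
def xSimilar (P Q : BPair) : Prop :=
  ∃ j k, (xShift j P).1 ∪ (xShift j P).2 = (xShift k Q).1 ∪ (xShift k Q).2 ∧
    (xShift j P).1 ∩ (xShift j P).2 = (xShift k Q).1 ∩ (xShift k Q).2

/-- A β-pair is reduced if it is not a proper shift, i.e. `0` does not lie in
both rows; each shift-equivalence class has a unique reduced representative. -/
def reduced (Λ : BPair) : Prop := ¬ (0 ∈ Λ.1 ∧ 0 ∈ Λ.2)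

/-- `a(Λ) + a(Ξ) = b(Λ⊕Ξ)`, computed (as in the paper) on shift-representatives
with matching row sizes. -/
def minimalPair (Λ Ξ : BPair) : Prop :=
  ∃ Λ' Ξ', pEquiv Λ Λ' ∧ pEquiv Ξ Ξ' ∧ Λ'.1.card = Ξ'.1.card ∧
    Λ'.2.card = Ξ'.2.card ∧ aFun Λ' + aFun Ξ' = bX (oplus Λ' Ξ')

/-- The generating relation `i ≈ i+1` whenever `c_i = c_{i+1}` or `d_i = d_{i+1}`. -/
def linkRel (n : ℕ) (c d : ℕ → ℕ) (i j : Fin n) : Prop :=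
  (j : ℕ) = (i : ℕ) + 1 ∧ (c i = c j ∨ d i = d j)

/-- The equivalence relation generated by `linkRel`. -/
def idxSetoid (n : ℕ) (c d : ℕ → ℕ) : Setoid (Fin n) :=
  ⟨Relation.EqvGen (linkRel n c d), Relation.EqvGen.is_equivalence _⟩

/-- A degenerate equivalence class: `{i, i+1}` with `c_i = c_{i+1}` and
`d_i = d_{i+1}`. -/
def degenClass (n : ℕ) (c d : ℕ → ℕ) (Q : Quotient (idxSetoid n c d)) : Prop :=
  ∃ i j : Fin n, (j : ℕ) = (i : ℕ) + 1 ∧ c i = c j ∧ d i = d j ∧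
    Q = Quotient.mk (idxSetoid n c d) i ∧
    ∀ m : Fin n, Quotient.mk (idxSetoid n c d) m = Q → m = i ∨ m = j

/-- The number `ℓ` of non-degenerate equivalence classes. -/
noncomputable def ellCount (n : ℕ) (c d : ℕ → ℕ) : ℕ :=
  Nat.card {Q : Quotient (idxSetoid n c d) // ¬ degenClass n c d Q}

/-- `Ξ` is obtained from `Λ` by decreasing a single entry by `1`, the result
again being a β-pair. -/
def stepDown (Λ Ξ : BPair) : Prop :=
  (∃ x ∈ Λ.1, 0 < x ∧ x - 1 ∉ Λ.1 ∧ Ξ = (insert (x - 1) (Λ.1.erase x), Λ.2)) ∨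
  (∃ x ∈ Λ.2, 0 < x ∧ x - 1 ∉ Λ.2 ∧ Ξ = (Λ.1, insert (x - 1) (Λ.2.erase x)))

/-- The double sum `∑_{x ∈ M} ∑_{y ∈ N} min x y`. -/
def minSum (M N : Multiset ℕ) : ℕ := (M.map fun x => (N.map fun y => min x y).sum).sum

theorem minSum_add_left (M M' N : Multiset ℕ) :
    minSum (M + M') N = minSum M N + minSum M' N := by
  simp [minSum]

theorem minSum_add_right (M N N' : Multiset ℕ) :
    minSum M (N + N') = minSum M N + minSum M N' := by
  simp [minSum, Multiset.sum_map_add]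

theorem minSum_comm (M N : Multiset ℕ) : minSum M N = minSum N M := by
  unfold minSum
  rw [Multiset.sum_map_sum_map]
  simp only [min_comm]

theorem minSum_le_minSum {N U V : Multiset ℕ}
    (h : ∀ c, (U.map fun y => min c y).sum ≤ (V.map fun y => min c y).sum) :
    minSum N U ≤ minSum N V :=
  Multiset.sum_map_le_sum_map _ _ fun c _ => h c

/-- For a weakly increasing list, the weighted sum in `wsum` counts each pairwise minimum. -/
theorem two_mul_weighted_sum {L : List ℕ} (hL : L.Pairwise (· ≤ ·)) :
    2 * ∑ j ∈ Finset.range L.length, (L.length - 1 - j) * L.getD j 0 + L.sum =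
      minSum L L := by
  induction L with
  | nil => simp [minSum]
  | cons a L ih =>
    rw [List.pairwise_cons] at hL
    have hmin : (L.map fun y => min a y) = L.map fun _ => a :=
      List.map_congr_left fun y hy => min_eq_left (hL.1 y hy)
    have hcons : minSum (a :: L : List ℕ) (a :: L : List ℕ)
        = a + 2 * (L.length * a) + minSum L L := by
      rw [← Multiset.cons_coe, ← Multiset.singleton_add]
      simp only [minSum_add_left, minSum_add_right]
      rw [minSum_comm (L : Multiset ℕ) {a}]
      have : minSum {a} (L : Multiset ℕ) = L.length * a := by
        simp [minSum, hmin]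
      rw [this]
      simp [minSum]
      ring
    rw [hcons, ← ih hL.2, List.length_cons, Finset.sum_range_succ', List.sum_cons]
    have : ∀ j ∈ Finset.range L.length,
        (L.length + 1 - 1 - (j + 1)) * (a :: L).getD (j + 1) 0
          = (L.length - 1 - j) * L.getD j 0 := by
      intro j _
      rw [List.getD_cons_succ]
      congr 1
      omega
    rw [Finset.sum_congr rfl this]
    simp
    ring

theorem two_mul_wsum_sort (M : Multiset ℕ) (ref : ℕ → ℕ) :
    2 * wsum (M.sort (· ≤ ·)) ref = (minSum M M : ℤ) - (M.sum : ℤ) -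
      2 * ∑ j ∈ Finset.range M.card, ((M.card - 1 - j : ℕ) : ℤ) * (ref j : ℤ) := by
  have h := two_mul_weighted_sum (M.pairwise_sort (· ≤ ·))
  have hs : (M.sort (· ≤ ·)).sum = M.sum := by
    rw [← Multiset.sum_coe, Multiset.sort_eq]
  rw [Multiset.sort_eq, hs, Multiset.length_sort] at h
  unfold wsum
  rw [Multiset.length_sort, ← h]
  simp only [mul_sub, Finset.sum_sub_distrib]
  push_cast
  ring

theorem exists_threshold {s : ℕ} {f : ℕ → ℕ} (hf : ∀ i j, i ≤ j → j < s → f i ≤ f j) (c : ℕ) :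
    ∃ k ≤ s, (∀ i < k, f i ≤ c) ∧ ∀ i, k ≤ i → i < s → c ≤ f i := by
  induction s with
  | zero => exact ⟨0, le_rfl, by simp, by simp⟩
  | succ s ih =>
    by_cases h : f s ≤ c
    · exact ⟨s + 1, le_rfl, fun i hi => (hf i s (by omega) (by omega)).trans h, by omega⟩
    · obtain ⟨k, hk, h1, h2⟩ := ih fun i j hij hj => hf i j hij (by omega)
      refine ⟨k, by omega, h1, fun i hki hi => ?_⟩
      rcases Nat.lt_succ_iff_lt_or_eq.mp hi with hi | rfl
      · exact h2 i hki hi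
      · omega

/-- Truncation at `c` reverses dominance between sequences with equal sums. -/
theorem sum_min_le_sum_min {s : ℕ} {f g : ℕ → ℕ} (hf : ∀ i j, i ≤ j → j < s → f i ≤ f j)
    (htot : ∑ i ∈ Finset.range s, f i = ∑ i ∈ Finset.range s, g i)
    (hdom : ∀ k ≤ s, ∑ i ∈ Finset.Ico k s, f i ≤ ∑ i ∈ Finset.Ico k s, g i) (c : ℕ) :
    ∑ i ∈ Finset.range s, min c (g i) ≤ ∑ i ∈ Finset.range s, min c (f i) := by
  obtain ⟨k, hk, h1, h2⟩ := exists_threshold hf c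
  have hd := hdom k hk
  rw [← Finset.sum_range_add_sum_Ico _ hk] at htot ⊢
  rw [← Finset.sum_range_add_sum_Ico _ hk] at htot ⊢
  have e1 : ∑ i ∈ Finset.range k, min c (f i) = ∑ i ∈ Finset.range k, f i :=
    Finset.sum_congr rfl fun i hi => min_eq_right (h1 i (Finset.mem_range.mp hi))
  have e2 : ∑ i ∈ Finset.Ico k s, min c (f i) = ∑ i ∈ Finset.Ico k s, c :=
    Finset.sum_congr rfl fun i hi =>
      min_eq_left (h2 i (Finset.mem_Ico.mp hi).1 (Finset.mem_Ico.mp hi).2)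
  have l1 : ∑ i ∈ Finset.range k, min c (g i) ≤ ∑ i ∈ Finset.range k, g i :=
    Finset.sum_le_sum fun i _ => min_le_right _ _
  have l2 : ∑ i ∈ Finset.Ico k s, min c (g i) ≤ ∑ i ∈ Finset.Ico k s, c :=
    Finset.sum_le_sum fun i _ => min_le_left _ _
  omega

theorem minSum_map_range {s : ℕ} {f : ℕ → ℕ} (hf : ∀ i j, i ≤ j → j < s → f i ≤ f j) :
    minSum ((Multiset.range s).map f) ((Multiset.range s).map f) +
      ∑ i ∈ Finset.range s, (2 * i + 1) * f i = 2 * s * ∑ i ∈ Finset.range s, f i := by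
  induction s with
  | zero => simp [minSum]
  | succ s ih =>
    have ih := ih fun i j hij hj => hf i j hij (by omega)
    have hcross : minSum {f s} ((Multiset.range s).map f) = ∑ i ∈ Finset.range s, f i := by
      simp only [minSum, Multiset.map_singleton, Multiset.sum_singleton, Multiset.map_map,
        Function.comp_def]
      exact Finset.sum_congr rfl fun i hi =>
        min_eq_right (hf i s (Finset.mem_range.mp hi).le (Nat.lt_succ_self s))
    have hself : minSum {f s} {f s} = f s := by simp [minSum]
    rw [Multiset.range_succ, Multiset.map_cons, ← Multiset.singleton_add]
    simp only [minSum_add_left, minSum_add_right]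
    rw [minSum_comm ((Multiset.range s).map f) {f s}, hcross, hself, Finset.sum_range_succ, Finset.sum_range_succ]
    linarith

theorem sum_tail_sums (s : ℕ) (f : ℕ → ℕ) :
    ∑ k ∈ Finset.range s, ∑ i ∈ Finset.Ico k s, f i = ∑ i ∈ Finset.range s, (i + 1) * f i := by
  rw [Finset.sum_comm' (t' := Finset.range s) (s' := fun i => Finset.range (i + 1))]
  · simp
  · intro k i
    simp only [Finset.mem_range, Finset.mem_Ico]
    omega

theorem eq_of_minSum_map_range_eq {s : ℕ} {f g : ℕ → ℕ}
    (hf : ∀ i j, i ≤ j → j < s → f i ≤ f j) (hg : ∀ i j, i ≤ j → j < s → g i ≤ g j)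
    (htot : ∑ i ∈ Finset.range s, f i = ∑ i ∈ Finset.range s, g i)
    (hdom : ∀ k ≤ s, ∑ i ∈ Finset.Ico k s, f i ≤ ∑ i ∈ Finset.Ico k s, g i)
    (h : minSum ((Multiset.range s).map f) ((Multiset.range s).map f) =
      minSum ((Multiset.range s).map g) ((Multiset.range s).map g)) :
    ∀ i < s, f i = g i := by
  have hf' := minSum_map_range hf
  have hg' := minSum_map_range hg
  have key : ∀ u : ℕ → ℕ, ∑ i ∈ Finset.range s, (2 * i + 1) * u i + ∑ i ∈ Finset.range s, u i
      = 2 * ∑ k ∈ Finset.range s, ∑ i ∈ Finset.Ico k s, u i := by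
    intro u
    rw [sum_tail_sums, Finset.mul_sum, ← Finset.sum_add_distrib]
    exact Finset.sum_congr rfl fun i _ => by ring
  have kf := key f
  have kg := key g
  rw [htot] at hf' kf
  have hsum : ∑ k ∈ Finset.range s, ∑ i ∈ Finset.Ico k s, f i =
      ∑ k ∈ Finset.range s, ∑ i ∈ Finset.Ico k s, g i := by omega
  rw [Finset.sum_eq_sum_iff_of_le fun k hk => hdom k (Finset.mem_range.mp hk).le] at hsum
  have tails : ∀ k ≤ s, ∑ i ∈ Finset.Ico k s, f i = ∑ i ∈ Finset.Ico k s, g i := by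
    intro k hk
    rcases hk.lt_or_eq with hk | rfl
    · exact hsum k (Finset.mem_range.mpr hk)
    · simp
  intro i hi
  have h0 := tails i hi.le
  rw [Finset.sum_eq_sum_Ico_succ_bot hi, Finset.sum_eq_sum_Ico_succ_bot hi,
    tails (i + 1) hi] at h0
  omega

theorem nthEl_lt {A : Finset ℕ} {i j : ℕ} (hij : i < j) (hj : j < A.card) :
    nthEl A i < nthEl A j := by
  have hl : (A.sort (· ≤ ·)).length = A.card := A.length_sort (· ≤ ·)
  unfold nthEl
  rw [List.getD_eq_getElem _ _ (by omega), List.getD_eq_getElem _ _ (by omega)]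
  exact List.pairwise_iff_getElem.mp A.sortedLT_sort.pairwise i j _ _ hij

theorem map_nthEl (A : Finset ℕ) : (Multiset.range A.card).map (nthEl A) = A.val := by
  have hl : (A.sort (· ≤ ·)).length = A.card := A.length_sort (· ≤ ·)
  rw [← Finset.sort_eq A (· ≤ ·), ← Multiset.coe_range, Multiset.map_coe]
  congr 1
  refine List.ext_getElem (by simp [hl]) fun i h1 h2 => ?_
  simp only [List.getElem_map, List.getElem_range, nthEl]
  exact List.getD_eq_getElem _ _ h2

theorem sum_nthEl (A : Finset ℕ) : ∑ i ∈ Finset.range A.card, nthEl A i = ∑ a ∈ A, a := by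
  have h := congrArg Multiset.sum (map_nthEl A)
  rw [Finset.sum_eq_multiset_sum A, Multiset.map_id', ← h]
  rfl

theorem le_nthEl {A : Finset ℕ} {i : ℕ} (hi : i < A.card) : i ≤ nthEl A i := by
  induction i with
  | zero => exact Nat.zero_le _
  | succ i ih =>
    have h1 := ih (by omega)
    have h2 := nthEl_lt i.lt_add_one hi
    omega

theorem image_val_of_strictMono {s : ℕ} {f : ℕ → ℕ} (hf : ∀ i j, i < j → j < s → f i < f j) :
    ((Finset.range s).image f).val = (Multiset.range s).map f := by
  refine Finset.image_val_of_injOn fun i hi j hj hij => ?_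
  simp only [Finset.coe_range, Set.mem_Iio] at hi hj
  rcases lt_trichotomy i j with h | h | h
  · exact absurd hij (hf i j h hj).ne
  · exact h
  · exact absurd hij (hf j i h hi).ne'

theorem odot_val {A B : Finset ℕ} (h : B.card = A.card) :
    (odot A B).val = (Multiset.range A.card).map fun i => nthEl A i + nthEl B i - i := by
  refine image_val_of_strictMono fun i j hij hj => ?_
  have := nthEl_lt hij hj
  have := nthEl_lt (A := B) hij (by omega)
  have := le_nthEl hj
  have := le_nthEl (A := B) (i := j) (by omega)
  have := le_nthEl (hij.trans hj)
  have hAB : ∀ m, i + m < A.card → nthEl A i + m ≤ nthEl A (i + m) := by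
    intro m
    induction m with
    | zero => simp
    | succ m ih =>
      intro hm
      have h1 := ih (by omega)
      have h2 := nthEl_lt (A := A) (Nat.lt_succ_self (i + m)) hm
      simp only [Nat.succ_eq_add_one, add_assoc] at h2
      omega
  have := hAB (j - i) (by omega)
  rw [Nat.add_sub_cancel' hij.le] at this
  omega

theorem card_odot {A B : Finset ℕ} (h : B.card = A.card) : (odot A B).card = A.card := by
  rw [Finset.card_def, odot_val h]
  simp

theorem bRank_odot {A B : Finset ℕ} (h : B.card = A.card) :
    bRank (odot A B) = bRank A + bRank B := by
  have hsum : ∑ x ∈ odot A B, x + A.card.choose 2 = ∑ a ∈ A, a + ∑ b ∈ B, b := by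
    rw [Finset.sum_eq_multiset_sum, odot_val h, ← sum_nthEl A, ← sum_nthEl B, h,
      Nat.choose_two_right, ← Finset.sum_range_id]
    simp only [Multiset.map_map, Function.comp_def]
    change ∑ i ∈ Finset.range A.card, (nthEl A i + nthEl B i - i) + _ = _
    rw [← Finset.sum_add_distrib, ← Finset.sum_add_distrib]
    refine Finset.sum_congr rfl fun i hi => ?_
    have := le_nthEl (Finset.mem_range.mp hi)
    omega
  unfold bRank
  rw [card_odot h, h]
  zify at hsum
  linarith

/-- The multiset `{x_1 + c, x_2 + 1 + c, …, x_s + s - 1 + c}`. -/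
def spread (c : ℕ) (X : Finset ℕ) : Multiset ℕ :=
  (Multiset.range X.card).map fun i => nthEl X i + i + c

theorem image_spread (c : ℕ) (X : Finset ℕ) :
    ((Finset.range X.card).image fun i => nthEl X i + i + c).val = spread c X :=
  image_val_of_strictMono fun _ _ hij hj => by
    have := nthEl_lt hij hj
    omega

theorem spread_map_add (c d : ℕ) (X : Finset ℕ) :
    (spread c X).map (· + d) = spread (c + d) X := by
  simp [spread, add_assoc]

theorem spread_mono {X : Finset ℕ} (c : ℕ) :
    ∀ i j, i ≤ j → j < X.card → nthEl X i + i + c ≤ nthEl X j + j + c := by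
  intro i j hij hj
  rcases hij.lt_or_eq with h | rfl
  · have := nthEl_lt h hj
    omega
  · rfl

/-- `X` and `Y` have the same size and the same sum, and `X` is dominated by `Y`. -/
structure Majorized (X Y : Finset ℕ) : Prop where
  card_eq : X.card = Y.card
  sum_eq : ∑ x ∈ X, x = ∑ y ∈ Y, y
  dom : domLE X Y

namespace Majorized

variable {X Y : Finset ℕ}

theorem spread_dom (h : Majorized X Y) (c : ℕ) : ∀ k ≤ X.card,
    ∑ i ∈ Finset.Ico k X.card, (nthEl X i + i + c) ≤
      ∑ i ∈ Finset.Ico k X.card, (nthEl Y i + i + c) := by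
  intro k _
  have := h.dom k
  rw [← h.card_eq] at this
  simp only [Finset.sum_add_distrib]
  omega

theorem spread_total (h : Majorized X Y) (c : ℕ) :
    ∑ i ∈ Finset.range X.card, (nthEl X i + i + c) =
      ∑ i ∈ Finset.range X.card, (nthEl Y i + i + c) := by
  have h1 := sum_nthEl X
  have h2 := sum_nthEl Y
  have h3 := h.sum_eq
  rw [← h.card_eq] at h2
  simp only [Finset.sum_add_distrib]
  omega

theorem spread_sum (h : Majorized X Y) (c : ℕ) : (spread c X).sum = (spread c Y).sum := by
  have := h.spread_total c
  unfold spread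
  rw [← h.card_eq]
  exact this

theorem spread_card (h : Majorized X Y) (c : ℕ) : (spread c X).card = (spread c Y).card := by
  simp [spread, h.card_eq]

theorem minSum_le (h : Majorized X Y) (c : ℕ) (N : Multiset ℕ) :
    minSum N (spread c Y) ≤ minSum N (spread c X) := by
  refine minSum_le_minSum fun m => ?_
  unfold spread
  rw [← h.card_eq, Multiset.map_map, Multiset.map_map]
  exact sum_min_le_sum_min (spread_mono c) (h.spread_total c) (h.spread_dom c) m

theorem minSum_spread_le (h : Majorized X Y) (c : ℕ) :
    minSum (spread c Y) (spread c Y) ≤ minSum (spread c X) (spread c X) :=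
  (h.minSum_le c _).trans (by rw [minSum_comm]; exact h.minSum_le c _)

theorem eq_of_minSum_spread_eq (h : Majorized X Y) {c : ℕ}
    (heq : minSum (spread c Y) (spread c Y) = minSum (spread c X) (spread c X)) : X = Y := by
  have hpt : ∀ i < X.card, nthEl X i + i + c = nthEl Y i + i + c := by
    refine eq_of_minSum_map_range_eq (spread_mono c) ?_ (h.spread_total c) (h.spread_dom c) ?_
    · rw [h.card_eq]
      exact spread_mono c
    · simpa only [spread, h.card_eq] using heq.symm
  rw [← Finset.val_inj, ← map_nthEl X, ← map_nthEl Y, ← h.card_eq]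
  refine Multiset.map_congr rfl fun i hi => ?_
  have := hpt i (Multiset.mem_range.mp hi)
  omega

end Majorized

theorem wsum_spread_le_and_eq_iff {X1 X2 Y1 Y2 : Finset ℕ} (h1 : Majorized X1 Y1)
    (h2 : Majorized X2 Y2) (K : Multiset ℕ) (c d : ℕ) (ref : ℕ → ℕ) {P Q : BPair}
    (hP : P.1.val + P.2.val = K + spread c Y1 + spread d Y2)
    (hQ : Q.1.val + Q.2.val = K + spread c X1 + spread d X2) :
    wsum (entries P) ref ≤ wsum (entries Q) ref ∧
      (wsum (entries P) ref = wsum (entries Q) ref ↔ X1 = Y1 ∧ X2 = Y2) := by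
  have wP := two_mul_wsum_sort (K + spread c Y1 + spread d Y2) ref
  have wQ := two_mul_wsum_sort (K + spread c X1 + spread d X2) ref
  have hcard : (K + spread c X1 + spread d X2).card = (K + spread c Y1 + spread d Y2).card := by
    simp only [Multiset.card_add, h1.spread_card, h2.spread_card]
  have hsum : (K + spread c X1 + spread d X2).sum = (K + spread c Y1 + spread d Y2).sum := by
    simp only [Multiset.sum_add, h1.spread_sum, h2.spread_sum]
  rw [hcard, hsum] at wQ
  have entries_eq : ∀ R : BPair, entries R = (R.1.val + R.2.val).sort (· ≤ ·) := fun _ => rfl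
  rw [← hP, ← entries_eq, hP] at wP
  rw [← hQ, ← entries_eq] at wQ
  have expand : ∀ U V : Multiset ℕ, minSum (K + U + V) (K + U + V) = minSum K K +
      2 * minSum K U + 2 * minSum K V + 2 * minSum U V + minSum U U + minSum V V := by
    intro U V
    simp only [minSum_add_left, minSum_add_right, minSum_comm U K, minSum_comm V K,
      minSum_comm V U]
    ring
  have eP := expand (spread c Y1) (spread d Y2)
  have eQ := expand (spread c X1) (spread d X2)
  have k1 := h1.minSum_le c K
  have k2 := h2.minSum_le d K
  have cross : minSum (spread c Y1) (spread d Y2) ≤ minSum (spread c X1) (spread d X2) :=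
    (h2.minSum_le d _).trans (by
      rw [minSum_comm, minSum_comm (spread c X1)]
      exact h1.minSum_le c _)
  have s1 := h1.minSum_spread_le c
  have s2 := h2.minSum_spread_le d
  rw [← hQ] at eQ
  refine ⟨by omega, fun heq => ⟨h1.eq_of_minSum_spread_eq (c := c) (by omega),
    h2.eq_of_minSum_spread_eq (c := d) (by omega)⟩, ?_⟩
  rintro ⟨rfl, rfl⟩
  unfold entries
  rw [hP, hQ]

theorem evShift_val (k : ℕ) (S : Finset ℕ) :
    (evShift k S).val = (Multiset.range k).map (fun i => 2 * i) + S.val.map (· + 2 * k) := by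
  have hd : Disjoint ((Finset.range k).image fun i => 2 * i) (S.image (· + 2 * k)) := by
    rw [Finset.disjoint_left]
    simp only [Finset.mem_image, Finset.mem_range]
    rintro _ ⟨i, hi, rfl⟩ ⟨x, _, hx⟩
    omega
  unfold evShift
  rw [← Finset.disjUnion_eq_union _ _ hd, Finset.disjUnion_val,
    image_val_of_strictMono fun i j _ _ => by omega,
    Finset.image_val_of_injOn (add_left_injective _).injOn]

theorem odShift_val (k : ℕ) (S : Finset ℕ) :
    (odShift k S).val = (Multiset.range k).map (fun i => 2 * i + 1) + S.val.map (· + 2 * k) := by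
  have hd : Disjoint ((Finset.range k).image fun i => 2 * i + 1) (S.image (· + 2 * k)) := by
    rw [Finset.disjoint_left]
    simp only [Finset.mem_image, Finset.mem_range]
    rintro _ ⟨i, hi, rfl⟩ ⟨x, _, hx⟩
    omega
  unfold odShift
  rw [← Finset.disjUnion_eq_union _ _ hd, Finset.disjUnion_val,
    image_val_of_strictMono fun i j _ _ => by omega,
    Finset.image_val_of_injOn (add_left_injective _).injOn]

theorem insert_zero_image_spread (X : Finset ℕ) :
    (insert 0 ((Finset.range X.card).image fun i => nthEl X i + i + 2)).val =
      {0} + spread 2 X := by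
  rw [Finset.insert_val_of_notMem (by simp), image_spread, Multiset.singleton_add]

theorem piPos_theta'_val (d : ℕ) (X Y : Finset ℕ) :
    (piPos d (theta' (X, Y))).1.val + (piPos d (theta' (X, Y))).2.val =
      ((Multiset.range (d - 1)).map (fun i => 2 * i) + {2 * (d - 1)}) +
        spread (2 + 2 * (d - 1)) X + spread 0 Y := by
  have h : (theta' (X, Y)).2.val = spread 0 Y := image_spread 0 Y
  simp only [piPos, evShift_val, h]
  simp only [theta', insert_zero_image_spread, Multiset.map_add, spread_map_add,
    Multiset.map_singleton, zero_add, ← add_assoc]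

theorem piPos_theta_val (d : ℕ) (X Y : Finset ℕ) :
    (piPos d (theta (X, Y))).1.val + (piPos d (theta (X, Y))).2.val =
      ((Multiset.range (d - 1)).map (fun i => 2 * i) + {2 * (d - 1)}) +
        spread (2 + 2 * (d - 1)) X + spread 1 Y := by
  simp only [piPos, theta, evShift_val, insert_zero_image_spread, image_spread, Multiset.map_add,
    spread_map_add, Multiset.map_singleton, zero_add, ← add_assoc]

theorem piNeg_thetaT_val (e : ℕ) (X Y : Finset ℕ) :
    (piNeg e (thetaT (X, Y))).1.val + (piNeg e (thetaT (X, Y))).2.val =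
      ({0} + (Multiset.range (e + 1)).map (fun i => 2 * i + 1)) +
        spread (1 + 2 * (e + 1)) X + spread 2 Y := by
  simp only [piNeg, thetaT, theta, odShift_val, insert_zero_image_spread, image_spread,
    spread_map_add]
  abel

theorem thetaBar_val (X Y : Finset ℕ) :
    (thetaBar (X, Y)).1.val + (thetaBar (X, Y)).2.val = 0 + spread 0 X + spread 0 Y := by
  rw [zero_add, ← image_spread 0 X, ← image_spread 0 Y]
  rfl

theorem majorized_odot {A B X : Finset ℕ} (hB : B.card = A.card) (hX : X.card = A.card)
    (hr : bRank X = bRank A + bRank B) (hd : domLE X (odot A B)) : Majorized X (odot A B) where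
  card_eq := hX.trans (card_odot hB).symm
  sum_eq := by
    rw [← bRank_odot hB] at hr
    unfold bRank at hr
    rw [hX, card_odot hB] at hr
    zify
    linarith
  dom := hd

/-- if `rk X_i = rk A_i + rk B_i` and `X_i ⊴ A_i⊙B_i` then
`b(Δ(A_1⊙B_1, A_2⊙B_2)) ≤ b(Δ(X_1,X_2))` for each of the maps `Δ`, with
equality iff `X_i = A_i⊙B_i`. -/
theorem statement_10 (s : ℕ) (A1 A2 B1 B2 X1 X2 : Finset ℕ)
    (hA1 : A1.card = s) (hA2 : A2.card = s) (hB1 : B1.card = s) (hB2 : B2.card = s)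
    (hX1 : X1.card = s) (hX2 : X2.card = s)
    (hr1 : bRank X1 = bRank A1 + bRank B1) (hr2 : bRank X2 = bRank A2 + bRank B2)
    (hd1 : domLE X1 (odot A1 B1)) (hd2 : domLE X2 (odot A2 B2)) :
    (∀ t : ℕ,
      bX (deltaB t (odot A1 B1, odot A2 B2)) ≤ bX (deltaB t (X1, X2)) ∧
      (bX (deltaB t (odot A1 B1, odot A2 B2)) = bX (deltaB t (X1, X2)) ↔
        X1 = odot A1 B1 ∧ X2 = odot A2 B2)) ∧
    (∀ t : ℕ,
      bY (deltaC t (odot A1 B1, odot A2 B2)) ≤ bY (deltaC t (X1, X2)) ∧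
      (bY (deltaC t (odot A1 B1, odot A2 B2)) = bY (deltaC t (X1, X2)) ↔
        X1 = odot A1 B1 ∧ X2 = odot A2 B2)) ∧
    (∀ t : ℕ, 1 ≤ t →
      bY (deltaC' t (odot A1 B1, odot A2 B2)) ≤ bY (deltaC' t (X1, X2)) ∧
      (bY (deltaC' t (odot A1 B1, odot A2 B2)) = bY (deltaC' t (X1, X2)) ↔
        X1 = odot A1 B1 ∧ X2 = odot A2 B2)) ∧
    (∀ t : ℕ, 1 ≤ t →
      bX (deltaD t (odot A1 B1, odot A2 B2)) ≤ bX (deltaD t (X1, X2)) ∧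
      (bX (deltaD t (odot A1 B1, odot A2 B2)) = bX (deltaD t (X1, X2)) ↔
        X1 = odot A1 B1 ∧ X2 = odot A2 B2)) ∧
    (bX (deltaD0 (odot A1 B1, odot A2 B2)) ≤ bX (deltaD0 (X1, X2)) ∧
      (bX (deltaD0 (odot A1 B1, odot A2 B2)) = bX (deltaD0 (X1, X2)) ↔
        X1 = odot A1 B1 ∧ X2 = odot A2 B2)) := by
  have h1 := majorized_odot (hB1.trans hA1.symm) (hX1.trans hA1.symm) hr1 hd1
  have h2 := majorized_odot (hB2.trans hA2.symm) (hX2.trans hA2.symm) hr2 hd2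
  exact ⟨
    fun _ => wsum_spread_le_and_eq_iff h1 h2 _ _ _ _ (piPos_theta'_val _ _ _)
      (piPos_theta'_val _ _ _),
    fun _ => wsum_spread_le_and_eq_iff h1 h2 _ _ _ _ (piPos_theta_val _ _ _)
      (piPos_theta_val _ _ _),
    fun _ _ => wsum_spread_le_and_eq_iff h1 h2 _ _ _ _ (piNeg_thetaT_val _ _ _)
      (piNeg_thetaT_val _ _ _),
    fun _ _ => wsum_spread_le_and_eq_iff h1 h2 _ _ _ _ (piPos_theta'_val _ _ _)
      (piPos_theta'_val _ _ _),
    wsum_spread_le_and_eq_iff h1 h2 _ _ _ _ (thetaBar_val _ _) (thetaBar_val _ _)⟩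

end CSpaper
end

section
/- (Type B case.) Let t, p ≥ 0 and let Λ = (A,B) and Ξ = (A',B') be β-pairs of defect 2t+1 as in the context. Then, computing b(Λ⊕Ξ) with the 𝕏-reference sequence, one has a(Λ) + a(Ξ) ≤ b(Λ⊕Ξ); moreover equality holds if and only if for every 1 ≤ i ≤ p+2t+1 and every 1 ≤ j ≤ p, either (a_i ≤ b_j and a_i' ≤ b_j') or (a_i ≥ b_j and a_i' ≥ b_j'). -/
namespace CSpaper

/-- The sum of `min x y` over all unordered pairs of positions of a list. -/
def pairMinSum : List ℕ → ℤ
  | [] => 0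
  | x :: l => (l.map fun y => ((min x y : ℕ) : ℤ)).sum + pairMinSum l

theorem pairMinSum_perm {l l' : List ℕ} (h : l.Perm l') : pairMinSum l = pairMinSum l' := by
  induction h with
  | nil => rfl
  | cons x h ih => simp only [pairMinSum, ih, (h.map _).sum_eq]
  | swap x y l => simp only [pairMinSum, List.map_cons, List.sum_cons, min_comm x y]; ring
  | trans _ _ ih ih' => exact ih.trans ih'

theorem pairMinSum_append (l l' : List ℕ) :
    pairMinSum (l ++ l') = pairMinSum l + pairMinSum l' +
      (l.map fun x => (l'.map fun y => ((min x y : ℕ) : ℤ)).sum).sum := by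
  induction l with
  | nil => simp [pairMinSum]
  | cons x l ih =>
    simp only [List.cons_append, pairMinSum, ih, List.map_append, List.sum_append, List.map_cons,
      List.sum_cons]
    ring

theorem pairMinSum_map_add {ι : Type*} (f g : ι → ℕ) (l : List ι)
    (h : l.Pairwise fun i j => f i ≤ f j ∧ g i ≤ g j) :
    pairMinSum (l.map fun i => f i + g i) = pairMinSum (l.map f) + pairMinSum (l.map g) := by
  induction h with
  | nil => simp [pairMinSum]
  | @cons a l hl _ ih =>
    have key : (l.map fun j => ((min (f a + g a) (f j + g j) : ℕ) : ℤ)).sum =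
        (l.map fun j => ((min (f a) (f j) : ℕ) : ℤ)).sum +
          (l.map fun j => ((min (g a) (g j) : ℕ) : ℤ)).sum := by
      rw [← List.sum_map_add]
      congr 1
      refine List.map_congr_left fun j hj => ?_
      have := hl j hj
      rw [min_eq_left this.1, min_eq_left this.2, min_eq_left (add_le_add this.1 this.2)]
      push_cast
      rfl
    simp only [List.map_cons, pairMinSum, List.map_map, Function.comp_def, ih, key]
    ring

theorem wsum_zero_of_pairwise_le {l : List ℕ} (h : l.Pairwise (· ≤ ·)) :
    wsum l (fun _ => 0) = pairMinSum l := by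
  induction h with
  | nil => simp [wsum, pairMinSum]
  | @cons a l hl _ ih =>
    have key : l.map (fun y => ((min a y : ℕ) : ℤ)) = l.map fun _ => (a : ℤ) :=
      List.map_congr_left fun j hj => by rw [min_eq_left (hl j hj)]
    rw [pairMinSum, ← ih, key, wsum, wsum, List.length_cons, Finset.sum_range_succ', add_comm]
    simp only [Nat.add_sub_cancel, List.getD_cons_succ, List.getD_cons_zero, Nat.sub_zero,
      Nat.cast_zero, sub_zero, List.map_const', List.sum_replicate, nsmul_eq_mul]
    congr 1
    refine Finset.sum_congr rfl fun j _ => ?_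
    rw [show l.length - (j + 1) = l.length - 1 - j by omega]

theorem wsum_eq_sub (l : List ℕ) (ref : ℕ → ℕ) :
    wsum l ref = wsum l (fun _ => 0) -
      ∑ j ∈ Finset.range l.length, ((l.length - 1 - j : ℕ) : ℤ) * (ref j : ℤ) := by
  rw [wsum, wsum, ← Finset.sum_sub_distrib]
  exact Finset.sum_congr rfl fun j _ => by push_cast; ring

theorem length_entries (P : BPair) : (entries P).length = P.1.card + P.2.card := by
  simp [entries]

theorem wsum_entries (P : BPair) (ref : ℕ → ℕ) {l l' : List ℕ}
    (h : P.1.val = (l : Multiset ℕ)) (h' : P.2.val = (l' : Multiset ℕ)) :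
    wsum (entries P) ref = pairMinSum (l ++ l') -
      ∑ j ∈ Finset.range (P.1.card + P.2.card),
        ((P.1.card + P.2.card - 1 - j : ℕ) : ℤ) * (ref j : ℤ) := by
  have hperm : (entries P).Perm (l ++ l') := by
    rw [← Multiset.coe_eq_coe, ← Multiset.coe_add, ← h, ← h']
    exact Multiset.sort_eq _ _
  have hsorted : (entries P).Pairwise (· ≤ ·) := Multiset.pairwise_sort _ _
  rw [wsum_eq_sub, length_entries, wsum_zero_of_pairwise_le hsorted, pairMinSum_perm hperm]

theorem map_nthEl_range (X : Finset ℕ) :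
    (List.range X.card).map (nthEl X) = X.sort (· ≤ ·) := by
  apply List.ext_getElem
  · simp
  · intro i h h'
    simp only [List.getElem_map, List.getElem_range, nthEl]
    exact List.getD_eq_getElem _ _ h'

theorem val_eq_map_nthEl (X : Finset ℕ) :
    X.val = ((List.range X.card).map (nthEl X) : List ℕ) := by
  rw [map_nthEl_range]
  exact (Finset.sort_eq _ _).symm

theorem nthEl_lt_nthEl {X : Finset ℕ} {i j : ℕ} (hij : i < j) (hj : j < X.card) :
    nthEl X i < nthEl X j := by
  have h := (Finset.sortedLT_sort X).pairwise
  rw [← map_nthEl_range, List.pairwise_map, List.pairwise_iff_getElem] at h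
  have h' := h i j (by rw [List.length_range]; exact hij.trans hj)
    (by rwa [List.length_range]) hij
  rwa [List.getElem_range, List.getElem_range] at h'

theorem injOn_nthEl_add {X X' : Finset ℕ} (h : X'.card = X.card) :
    Set.InjOn (fun i => nthEl X i + nthEl X' i) (Finset.range X.card : Set ℕ) := by
  have hlt : ∀ i j, i < j → j < X.card →
      nthEl X i + nthEl X' i < nthEl X j + nthEl X' j := fun i j hij hj =>
    add_lt_add (nthEl_lt_nthEl hij hj) (nthEl_lt_nthEl hij (h ▸ hj))
  intro i hi j hj hij
  simp only [Finset.coe_range, Set.mem_Iio] at hi hj hij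
  rcases lt_trichotomy i j with hlt' | rfl | hlt'
  · exact absurd hij (hlt _ _ hlt' hj).ne
  · rfl
  · exact absurd hij (hlt _ _ hlt' hi).ne'

theorem card_addRows {X X' : Finset ℕ} (h : X'.card = X.card) :
    (addRows X X').card = X.card := by
  rw [addRows, Finset.card_image_of_injOn (injOn_nthEl_add h), Finset.card_range]

theorem val_addRows {X X' : Finset ℕ} (h : X'.card = X.card) :
    (addRows X X').val =
      ((List.range X.card).map fun i => nthEl X i + nthEl X' i : List ℕ) := by
  rw [addRows, Finset.image_val_of_injOn (injOn_nthEl_add h)]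
  rfl

theorem pairMinSum_map_nthEl_add {X X' : Finset ℕ} (h : X'.card = X.card) :
    pairMinSum ((List.range X.card).map fun i => nthEl X i + nthEl X' i) =
      pairMinSum ((List.range X.card).map (nthEl X)) +
        pairMinSum ((List.range X.card).map (nthEl X')) := by
  refine pairMinSum_map_add _ _ _ (List.pairwise_iff_getElem.2 fun i j hi hj hij => ?_)
  simp only [List.length_range] at hi hj
  simp only [List.getElem_range]
  exact ⟨(nthEl_lt_nthEl hij hj).le, (nthEl_lt_nthEl hij (h ▸ hj)).le⟩

theorem sum_map_map_range (n p : ℕ) (f g : ℕ → ℕ) :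
    (((List.range n).map f).map fun x =>
      (((List.range p).map g).map fun y => ((min x y : ℕ) : ℤ)).sum).sum =
      ∑ i ∈ Finset.range n, ∑ j ∈ Finset.range p, ((min (f i) (g j) : ℕ) : ℤ) := by
  simp only [List.map_map]
  rfl

theorem bX_oplus_sub (A B A' B' : Finset ℕ) (hA : A'.card = A.card) (hB : B'.card = B.card) :
    bX (oplus (A, B) (A', B')) - (aFun (A, B) + aFun (A', B')) =
      ∑ i ∈ Finset.range A.card, ∑ j ∈ Finset.range B.card,
        (((min (nthEl A i + nthEl A' i) (nthEl B j + nthEl B' j) : ℕ) : ℤ) -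
          (((min (nthEl A i) (nthEl B j) : ℕ) : ℤ) +
            ((min (nthEl A' i) (nthEl B' j) : ℕ) : ℤ))) := by
  have href : ∀ n : ℕ, ∑ j ∈ Finset.range n, ((n - 1 - j : ℕ) : ℤ) * ((2 * (j / 2) : ℕ) : ℤ) =
      2 * ∑ j ∈ Finset.range n, ((n - 1 - j : ℕ) : ℤ) * ((j / 2 : ℕ) : ℤ) := fun n => by
    rw [Finset.mul_sum]
    exact Finset.sum_congr rfl fun j _ => by push_cast; ring
  rw [bX, aFun, aFun, wsum_entries (oplus (A, B) (A', B')) _ (val_addRows hA) (val_addRows hB),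
    wsum_entries (A, B) _ (val_eq_map_nthEl A) (val_eq_map_nthEl B),
    wsum_entries (A', B') _ (val_eq_map_nthEl A') (val_eq_map_nthEl B')]
  simp only [oplus, card_addRows hA, card_addRows hB, hA, hB, pairMinSum_append,
    sum_map_map_range, pairMinSum_map_nthEl_add hA, pairMinSum_map_nthEl_add hB, href,
    Finset.sum_sub_distrib, Finset.sum_add_distrib]
  ring

/-- type B: `a(Λ) + a(Ξ) ≤ b(Λ⊕Ξ)` with the 𝕏-reference
sequence, with equality iff for all `i`, `j` either `a_i ≤ b_j ∧ a_i' ≤ b_j'`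
or `a_i ≥ b_j ∧ a_i' ≥ b_j'`. -/
theorem statement_11 (t p : ℕ) (A B A' B' : Finset ℕ)
    (hA : A.card = p + 2 * t + 1) (hB : B.card = p)
    (hA' : A'.card = p + 2 * t + 1) (hB' : B'.card = p) :
    aFun (A, B) + aFun (A', B') ≤ bX (oplus (A, B) (A', B')) ∧
    (aFun (A, B) + aFun (A', B') = bX (oplus (A, B) (A', B')) ↔
      ∀ i < p + 2 * t + 1, ∀ j < p,
        (nthEl A i ≤ nthEl B j ∧ nthEl A' i ≤ nthEl B' j) ∨
        (nthEl B j ≤ nthEl A i ∧ nthEl B' j ≤ nthEl A' i)) := by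
  have hAA : A'.card = A.card := hA'.trans hA.symm
  have hBB : B'.card = B.card := hB'.trans hB.symm
  have key := bX_oplus_sub A B A' B' hAA hBB
  rw [hA, hB] at key
  have hnn : ∀ i j, (0 : ℤ) ≤
      ((min (nthEl A i + nthEl A' i) (nthEl B j + nthEl B' j) : ℕ) : ℤ) -
        (((min (nthEl A i) (nthEl B j) : ℕ) : ℤ) + ((min (nthEl A' i) (nthEl B' j) : ℕ) : ℤ)) :=
    fun i j => by omega
  refine ⟨sub_nonneg.1 (key ▸ Finset.sum_nonneg fun i _ => Finset.sum_nonneg fun j _ => hnn i j),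
    ?_⟩
  rw [eq_comm, ← sub_eq_zero, key,
    Finset.sum_eq_zero_iff_of_nonneg fun i _ => Finset.sum_nonneg fun j _ => hnn i j]
  simp only [Finset.sum_eq_zero_iff_of_nonneg fun j _ => hnn _ j, Finset.mem_range]
  refine forall₂_congr fun i _ => forall₂_congr fun j _ => ?_
  omega

end CSpaper
end

section
/- (Type B: cardinality of the set of minimizing pairs.) Let a, b ≥ 0 and let V and W be similarity classes of symbols of rank a and rank b respectively, all of odd positive defect, and suppose there exists (Λ_0,Ξ_0) ∈ V × W with d(Λ_0) = d(Ξ_0). Represent Λ_0 and Ξ_0 (after shifts) so that each of their four rows contains 0 and so that Λ_0 and Ξ_0 have the same total number 2k+1 of entries; write the entries of Λ_0 (with multiplicity) as c_1 ≤ … ≤ c_{2k+1} and those of Ξ_0 as d_1 ≤ … ≤ d_{2k+1}. Let ≈ be the equivalence relation on {1,…,2k+1} generated by: i ≈ i+1 whenever c_i = c_{i+1} or d_i = d_{i+1}; call an equivalence class I degenerate if I = {i, i+1} with c_i = c_{i+1} and d_i = d_{i+1}, and let ℓ be the number of non-degenerate equivalence classes. Then the number of pairs of symbols (Λ,Ξ)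 ∈ V × W with d(Λ) = d(Ξ) and a(Λ) + a(Ξ) = b(Λ⊕Ξ) (⊕ on representatives with matching row sizes as in the context, b with the 𝕏-reference sequence) equals 2^{ℓ−1}. -/
namespace CSpaper

section MinimalPairs

open Finset

/-- The multiset of all entries of a pair. -/
def pEntries (P : BPair) : Multiset ℕ := P.1.val + P.2.val

/-- The pair whose rows are the values of `c` on the two color classes of `E`. -/
def colorRows {n : ℕ} (c : Fin n → ℕ) (E : Fin n → Bool) : BPair :=
  ((univ.filter fun i => E i = true).image c, (univ.filter fun i => E i = false).image c)

/-- `c` is strictly increasing along each color class of `E`. -/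
def ClassStrictMono {n : ℕ} (c : Fin n → ℕ) (E : Fin n → Bool) : Prop :=
  ∀ i j, i < j → E i = E j → c i < c j

variable {n : ℕ} {c d : Fin n → ℕ} {E : Fin n → Bool}

lemma ClassStrictMono.strictMonoOn (h : ClassStrictMono c E) (b : Bool) :
    StrictMonoOn c (univ.filter fun i => E i = b : Finset (Fin n)) := by
  intro i hi j hj hij
  simp only [coe_filter, mem_univ, true_and, Set.mem_ofPred_eq] at hi hj
  exact h i j hij (hi.trans hj.symm)

lemma ClassStrictMono.add (h : ClassStrictMono c E) (h' : ClassStrictMono d E) :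
    ClassStrictMono (fun i => c i + d i) E := fun i j hij hE =>
  Nat.add_lt_add (h i j hij hE) (h' i j hij hE)

lemma card_pEntries (P : BPair) : (pEntries P).card = P.1.card + P.2.card := by
  simp [pEntries]

lemma pEntries_colorRows (h : ClassStrictMono c E) :
    pEntries (colorRows c E) = univ.val.map c := by
  simp only [pEntries, colorRows]
  rw [image_val_of_injOn (h.strictMonoOn true).injOn, image_val_of_injOn (h.strictMonoOn false).injOn,
    ← Multiset.map_add]
  congr 1
  have := Multiset.filter_add_not (fun i : Fin n => E i = true) univ.val
  simpa using this

lemma card_colorRows (h : ClassStrictMono c E) :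
    (colorRows c E).1.card = (univ.filter fun i => E i = true).card ∧
    (colorRows c E).2.card = (univ.filter fun i => E i = false).card :=
  ⟨card_image_of_injOn (h.strictMonoOn true).injOn,
    card_image_of_injOn (h.strictMonoOn false).injOn⟩

lemma nthEl_image {S : Finset (Fin n)} (hc : StrictMonoOn c S) {i : ℕ} (hi : i < S.card) :
    nthEl (S.image c) i = c ((S.sort).get ⟨i, by simpa using hi⟩) := by
  have h : (S.image c).sort = S.sort.map c := by
    refine List.Perm.eq_of_pairwise' (r := (· ≤ ·)) (pairwise_sort _ _) ?_ ?_
    · rw [List.pairwise_map]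
      refine (pairwise_sort S (· ≤ ·)).imp_of_mem fun {a b} ha hb hab => ?_
      exact hc.monotoneOn (by simpa using ha) (by simpa using hb) hab
    · rw [← Multiset.coe_eq_coe, sort_eq, ← Multiset.map_coe, sort_eq, image_val_of_injOn hc.injOn]
  unfold nthEl
  rw [h, List.getD_eq_getElem _ _ (by simpa using hi)]
  simp

lemma addRows_image {S : Finset (Fin n)} (hc : StrictMonoOn c S) (hd : StrictMonoOn d S) :
    addRows (S.image c) (S.image d) = S.image fun i => c i + d i := by
  ext x
  simp only [addRows, mem_image, mem_range, card_image_of_injOn hc.injOn]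
  constructor
  · rintro ⟨i, hi, rfl⟩
    rw [nthEl_image hc hi, nthEl_image hd hi]
    exact ⟨_, by rw [← mem_sort (r := (· ≤ ·))]; exact List.get_mem _ _, rfl⟩
  · rintro ⟨a, ha, rfl⟩
    rw [← mem_sort (r := (· ≤ ·))] at ha
    obtain ⟨⟨i, hi⟩, rfl⟩ := List.get_of_mem ha
    have hi' : i < S.card := by simpa using hi
    exact ⟨i, hi', by rw [nthEl_image hc hi', nthEl_image hd hi']⟩

lemma oplus_colorRows (hc : ClassStrictMono c E) (hd : ClassStrictMono d E) :
    oplus (colorRows c E) (colorRows d E) = colorRows (fun i => c i + d i) E :=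
  Prod.ext (addRows_image (hc.strictMonoOn true) (hd.strictMonoOn true))
    (addRows_image (hc.strictMonoOn false) (hd.strictMonoOn false))

lemma entries_eq_ofFn {P : BPair} (hc : Monotone c) (h : pEntries P = univ.val.map c) :
    entries P = List.ofFn c := by
  refine List.Perm.eq_of_pairwise' (r := (· ≤ ·)) (Multiset.pairwise_sort _ _) ?_ ?_
  · exact hc.sortedLE_ofFn.pairwise
  · rw [← Multiset.coe_eq_coe, entries, Multiset.sort_eq, ← Fin.univ_val_map]
    exact h

lemma wsum_ofFn (c : Fin n → ℕ) (ref : ℕ → ℕ) :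
    wsum (List.ofFn c) ref =
      ∑ i : Fin n, ((n - 1 - i : ℕ) : ℤ) * ((c i : ℤ) - (ref i : ℤ)) := by
  unfold wsum
  rw [List.length_ofFn, ← Fin.sum_univ_eq_sum_range (fun j => ((n - 1 - j : ℕ) : ℤ) *
    (((List.ofFn c).getD j 0 : ℤ) - (ref j : ℤ)))]
  refine sum_congr rfl fun i _ => ?_
  rw [List.getD_eq_getElem _ _ (by simp), List.getElem_ofFn]

/-- The linear functional of a sequence which `a` and `b` measure, up to a constant. -/
def weightedSum (c : Fin n → ℕ) : ℤ := ∑ i : Fin n, ((n - 1 - i : ℕ) : ℤ) * (c i : ℤ)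

lemma aFun_add_aFun_eq_bX_iff {P Q R : BPair} {w : Fin n → ℕ}
    (hc : Monotone c) (hd : Monotone d) (hw : Monotone w)
    (hP : pEntries P = univ.val.map c) (hQ : pEntries Q = univ.val.map d)
    (hR : pEntries R = univ.val.map w) :
    aFun P + aFun Q = bX R ↔ weightedSum c + weightedSum d = weightedSum w := by
  unfold aFun bX weightedSum
  rw [entries_eq_ofFn hc hP, entries_eq_ofFn hd hQ, entries_eq_ofFn hw hR]
  simp only [wsum_ofFn, mul_sub, sum_sub_distrib]
  push_cast
  have : ∑ i : Fin n, ((n - 1 - (i : ℕ) : ℕ) : ℤ) * (2 * ((i : ℤ) / 2)) =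
      ∑ i : Fin n, ((n - 1 - (i : ℕ) : ℕ) : ℤ) * ((i : ℤ) / 2) +
      ∑ i : Fin n, ((n - 1 - (i : ℕ) : ℕ) : ℤ) * ((i : ℤ) / 2) := by
    rw [← sum_add_distrib]
    exact sum_congr rfl fun i _ => by ring
  rw [this]
  constructor <;> intro h <;> linarith

lemma weightedSum_add (c d : Fin n → ℕ) :
    weightedSum (fun i => c i + d i) = weightedSum c + weightedSum d := by
  simp [weightedSum, mul_add, sum_add_distrib]

lemma eq_of_monotone_of_map_eq (hc : Monotone c) (hd : Monotone d)
    (h : univ.val.map c = univ.val.map d) : c = d := by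
  rw [Fin.univ_val_map, Fin.univ_val_map, Multiset.coe_eq_coe] at h
  exact List.ofFn_injective (h.eq_of_sortedLE hc.sortedLE_ofFn hd.sortedLE_ofFn)

lemma weightedSum_le_and_eq {u : Fin n → ℕ} (hc : Monotone c)
    (h : univ.val.map u = univ.val.map c) :
    weightedSum c ≤ weightedSum u ∧ (weightedSum u = weightedSum c → u = c) := by
  have hs : u ∘ Tuple.sort u = c := by
    refine eq_of_monotone_of_map_eq (Tuple.monotone_sort u) hc ?_
    rw [← h, ← Multiset.map_map]
    congr 1
    exact congrArg Finset.val (map_univ_equiv (Tuple.sort u))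
  set σ := (Tuple.sort u)⁻¹ with hσ
  have hu : u = c ∘ σ := by
    rw [← hs]; ext i; simp [hσ]
  have hanti : Antivary (fun i : Fin n => ((n - 1 - i : ℕ) : ℤ)) (fun i => (c i : ℤ)) := by
    intro i j hij
    have hij' : i < j := hc.reflect_lt (Nat.cast_lt.1 hij)
    have := Fin.lt_def.1 hij'
    simp only [Nat.cast_le]
    omega
  have hus : weightedSum u =
      ∑ i : Fin n, ((n - 1 - i : ℕ) : ℤ) * (fun i => (c i : ℤ)) (σ i) := by
    simp [weightedSum, hu]
  refine ⟨by rw [hus]; exact hanti.sum_mul_le_sum_mul_comp_perm, fun he => ?_⟩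
  rw [hus] at he
  have ha := hanti.sum_mul_eq_sum_mul_comp_perm_iff.1 he
  refine eq_of_monotone_of_map_eq (fun i j hij => ?_) hc h
  by_contra! hlt
  have := ha (i := j) (j := i) (by simpa [hu] using hlt)
  simp only [Nat.cast_le] at this
  have h1 := i.2; have h2 := j.2; have h3 := Fin.le_def.1 hij
  have : i = j := Fin.ext (by omega)
  simp [this] at hlt

lemma exists_colorRows {P Q : BPair} (h1 : P.1.card = Q.1.card) (h2 : P.2.card = Q.2.card)
    (hn : P.1.card + P.2.card = n) :
    ∃ (E : Fin n → Bool) (u v : Fin n → ℕ), ClassStrictMono u E ∧ ClassStrictMono v E ∧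
      P = colorRows u E ∧ Q = colorRows v E ∧ (Monotone fun i => u i + v i) ∧ (P = Q → u = v) := by
  subst hn
  set s := P.1.card with hs
  set r := P.2.card with hr
  let U : Fin s ⊕ Fin r → ℕ := Sum.elim (P.1.orderEmbOfFin rfl) (P.2.orderEmbOfFin rfl)
  let V : Fin s ⊕ Fin r → ℕ := Sum.elim (Q.1.orderEmbOfFin h1.symm) (Q.2.orderEmbOfFin h2.symm)
  let e : Fin (s + r) ≃ Fin s ⊕ Fin r := finSumFinEquiv.symm
  let τ : Fin (s + r) ≃ Fin s ⊕ Fin r := (Tuple.sort fun i => U (e i) + V (e i)).trans e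
  have hmono : Monotone fun i => U (τ i) + V (τ i) :=
    Tuple.monotone_sort fun i => U (e i) + V (e i)
  have key : ∀ i j, i < j → (τ i).isLeft = (τ j).isLeft → U (τ i) < U (τ j) ∧ V (τ i) < V (τ j) := by
    intro i j hij hE
    have hne : τ i ≠ τ j := fun h => hij.ne (τ.injective h)
    have hle := hmono hij.le
    simp only at hle
    rcases hi : τ i with a | a <;> rcases hj : τ j with b | b
    · rw [hi, hj] at hne hle
      simp only [U, V, Sum.elim_inl, OrderEmbedding.lt_iff_lt, and_self] at hle ⊢
      by_contra! hba
      have hba' : b < a := lt_of_le_of_ne hba fun h => hne (by rw [h])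
      have x1 := (P.1.orderEmbOfFin rfl).strictMono hba'
      have x2 := (Q.1.orderEmbOfFin h1.symm).strictMono hba'
      omega
    · simp [hi, hj] at hE
    · simp [hi, hj] at hE
    · rw [hi, hj] at hne hle
      simp only [U, V, Sum.elim_inr, OrderEmbedding.lt_iff_lt, and_self] at hle ⊢
      by_contra! hba
      have hba' : b < a := lt_of_le_of_ne hba fun h => hne (by rw [h])
      have x1 := (P.2.orderEmbOfFin rfl).strictMono hba'
      have x2 := (Q.2.orderEmbOfFin h2.symm).strictMono hba'
      omega
  have rows : ∀ (W : Fin s ⊕ Fin r → ℕ) (R : BPair),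
      (∀ x, x ∈ R.1 ↔ ∃ a, W (Sum.inl a) = x) → (∀ x, x ∈ R.2 ↔ ∃ a, W (Sum.inr a) = x) →
      R = colorRows (fun i => W (τ i)) fun i => (τ i).isLeft := by
    intro W R hR1 hR2
    refine Prod.ext ?_ ?_ <;> ext x
    · simp only [colorRows, mem_image, mem_filter, mem_univ, true_and, hR1]
      constructor
      · rintro ⟨a, rfl⟩
        exact ⟨τ.symm (Sum.inl a), by simp⟩
      · rintro ⟨i, hi, rfl⟩
        obtain ⟨a, ha⟩ := Sum.isLeft_iff.1 hi
        exact ⟨a, by rw [ha]⟩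
    · simp only [colorRows, mem_image, mem_filter, mem_univ, true_and, hR2]
      constructor
      · rintro ⟨a, rfl⟩
        exact ⟨τ.symm (Sum.inr a), by simp⟩
      · rintro ⟨i, hi, rfl⟩
        obtain ⟨a, ha⟩ := Sum.isRight_iff.1 (Sum.isLeft_eq_false.1 hi)
        exact ⟨a, by rw [ha]⟩
  have memR : ∀ {A : Finset ℕ} {m : ℕ} (h : A.card = m) (x : ℕ),
      x ∈ A ↔ ∃ a, A.orderEmbOfFin h a = x := by
    intro A m h x
    rw [← mem_coe, ← range_orderEmbOfFin A h, Set.mem_range]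
  refine ⟨fun i => (τ i).isLeft, fun i => U (τ i), fun i => V (τ i),
    fun i j hij hE => (key i j hij hE).1, fun i j hij hE => (key i j hij hE).2,
    rows U P (memR _) (memR _), rows V Q (memR _) (memR _), hmono, ?_⟩
  rintro rfl
  rfl

/-- The pairs of β-pairs with prescribed entries `c` and `d`, matching row sizes, and minimal
`b`-value. -/
def minimalPairs (c d : Fin n → ℕ) : Set (BPair × BPair) :=
  {R | pEntries R.1 = univ.val.map c ∧ pEntries R.2 = univ.val.map d ∧
    R.1.1.card = R.2.1.card ∧ R.1.2.card = R.2.2.card ∧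
    aFun R.1 + aFun R.2 = bX (oplus R.1 R.2)}

lemma mem_minimalPairs_iff (hc : Monotone c) (hd : Monotone d) (R : BPair × BPair) :
    R ∈ minimalPairs c d ↔ ∃ E, ClassStrictMono c E ∧ ClassStrictMono d E ∧
      (colorRows c E, colorRows d E) = R := by
  constructor
  · rintro ⟨h1, h2, h3, h4, h5⟩
    have hn : R.1.1.card + R.1.2.card = n := by
      rw [← card_pEntries, h1]; simp
    obtain ⟨E, u, v, hu, hv, hP, hQ, hw, -⟩ := exists_colorRows h3 h4 hn
    have hu' := pEntries_colorRows hu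
    have hv' := pEntries_colorRows hv
    have hw' := pEntries_colorRows (hu.add hv)
    rw [← oplus_colorRows hu hv, ← hP, ← hQ] at hw'
    rw [← hP, h1] at hu'
    rw [← hQ, h2] at hv'
    rw [aFun_add_aFun_eq_bX_iff hc hd hw h1 h2 hw', weightedSum_add] at h5
    obtain ⟨a1, a2⟩ := weightedSum_le_and_eq hc hu'.symm
    obtain ⟨b1, b2⟩ := weightedSum_le_and_eq hd hv'.symm
    obtain rfl := a2 (by linarith)
    obtain rfl := b2 (by linarith)
    exact ⟨E, hu, hv, Prod.ext hP.symm hQ.symm⟩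
  · rintro ⟨E, hu, hv, rfl⟩
    obtain ⟨a1, a2⟩ := card_colorRows hu
    obtain ⟨b1, b2⟩ := card_colorRows hv
    refine ⟨pEntries_colorRows hu, pEntries_colorRows hv, a1.trans b1.symm, a2.trans b2.symm, ?_⟩
    have hw' := pEntries_colorRows (hu.add hv)
    rw [← oplus_colorRows hu hv] at hw'
    exact (aFun_add_aFun_eq_bX_iff hc hd (fun i j hij => Nat.add_le_add (hc hij) (hd hij))
      (pEntries_colorRows hu) (pEntries_colorRows hv) hw').2 (weightedSum_add c d).symm

lemma exists_classStrictMono {P : BPair} (hc : Monotone c) (h : pEntries P = univ.val.map c) :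
    ∃ E, ClassStrictMono c E := by
  have hn : P.1.card + P.2.card = n := by rw [← card_pEntries, h]; simp
  obtain ⟨E, u, v, hu, -, hP, -, hw, huv⟩ := exists_colorRows (P := P) (Q := P) rfl rfl hn
  obtain rfl := huv rfl
  have hmu : Monotone u := fun i j hij => by
    have := hw hij
    simp only at this
    omega
  have huc : u = c := eq_of_monotone_of_map_eq hmu hc (by rw [← pEntries_colorRows hu, ← hP, h])
  exact ⟨E, huc ▸ hu⟩

lemma ClassStrictMono.not_three (h : ClassStrictMono c E) {i j k : Fin n} (hij : i < j)
    (hjk : j < k) (h1 : c i = c j) (h2 : c j = c k) : False := by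
  have a1 := h i j hij
  have a2 := h j k hjk
  have a3 := h i k (hij.trans hjk)
  cases hi : E i <;> cases hj : E j <;> cases hk : E k <;> simp_all

lemma eq_succ_of_eq (hc : Monotone c) {i j k : Fin n} (hij : i < j)
    (hk : (k : ℕ) = i + 1) (h : c i = c j) : c i = c k :=
  le_antisymm (hc (Fin.le_def.2 (by omega)))
    ((hc (Fin.le_def.2 (by have := Fin.lt_def.1 hij; omega))).trans h.ge)

lemma classStrictMono_iff (hc : Monotone c) (hE : ∃ E, ClassStrictMono c E) :
    ClassStrictMono c E ↔ ∀ i j : Fin n, (j : ℕ) = i + 1 → c i = c j → E i ≠ E j := by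
  constructor
  · intro h i j hij hcij hE
    exact (h i j (Fin.lt_def.2 (by omega)) hE).ne hcij
  · intro h i j hij hEij
    refine lt_of_le_of_ne (hc hij.le) fun heq => ?_
    obtain ⟨E₀, h₀⟩ := hE
    have hlt := Fin.lt_def.1 hij
    let k : Fin n := ⟨i + 1, by omega⟩
    have hk : c i = c k := eq_succ_of_eq hc hij rfl heq
    by_cases hkj : k = j
    · exact h i j (by rw [← hkj]) heq hEij
    · have hkj' : k < j := lt_of_le_of_ne (Fin.le_def.2 hlt) hkj
      exact h₀.not_three (Fin.lt_def.2 (Nat.lt_succ_self _)) hkj' hk (hk.symm.trans heq)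

section Counting

variable {C D : ℕ → ℕ}

/-- The coloring which alternates along each class, starting from the choice `δ`. -/
def alternating (δ : Quotient (idxSetoid n C D) → Bool) : Fin n → Bool :=
  fun i => xor (δ (Quotient.mk _ i)) (decide ((i : ℕ) % 2 = 1))

lemma linkRel_mk_eq {i j : Fin n} (h : linkRel n C D i j) :
    Quotient.mk (idxSetoid n C D) i = Quotient.mk _ j :=
  Quotient.sound (Relation.EqvGen.rel _ _ h)

lemma alternating_ne {δ : Quotient (idxSetoid n C D) → Bool} {i j : Fin n}
    (h : linkRel n C D i j) : alternating δ i ≠ alternating δ j := by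
  unfold alternating
  rw [linkRel_mk_eq h, h.1]
  rcases Nat.mod_two_eq_zero_or_one i with hi | hi <;> simp [Nat.add_mod, hi]

lemma exists_eq_alternating
    (h : ∀ i j : Fin n, linkRel n C D i j → E i ≠ E j) :
    ∃ δ : Quotient (idxSetoid n C D) → Bool, E = alternating δ := by
  refine ⟨Quotient.lift (fun i => xor (E i) (decide ((i : ℕ) % 2 = 1))) fun i j hij => ?_, ?_⟩
  · induction (hij : Relation.EqvGen (linkRel n C D) i j) with
    | rel i j hr =>
      have := h i j hr
      simp only [hr.1]
      rcases Nat.mod_two_eq_zero_or_one i with hi | hi <;>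
        cases h1 : E i <;> cases h2 : E j <;> simp_all [Nat.add_mod]
    | refl i => rfl
    | symm i j _ ih => exact ih.symm
    | trans i j k _ _ ih1 ih2 => exact ih1.trans ih2
  · funext i
    simp [alternating]

lemma classStrictMono_and_iff (hc : Monotone fun i : Fin n => C i)
    (hd : Monotone fun i : Fin n => D i) (hc' : ∃ E, ClassStrictMono (fun i : Fin n => C i) E)
    (hd' : ∃ E, ClassStrictMono (fun i : Fin n => D i) E) :
    (ClassStrictMono (fun i : Fin n => C i) E ∧ ClassStrictMono (fun i : Fin n => D i) E) ↔
      ∃ δ : Quotient (idxSetoid n C D) → Bool, E = alternating δ := by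
  rw [classStrictMono_iff hc hc', classStrictMono_iff hd hd']
  constructor
  · rintro ⟨h1, h2⟩
    exact exists_eq_alternating fun i j hij => hij.2.elim (h1 i j hij.1) (h2 i j hij.1)
  · rintro ⟨δ, rfl⟩
    exact ⟨fun i j hij h => alternating_ne ⟨hij, Or.inl h⟩,
      fun i j hij h => alternating_ne ⟨hij, Or.inr h⟩⟩

lemma colorRows_eq_of_forall {E E' : Fin n → Bool} (h : ∀ i, ∃ j, c j = c i ∧ E' j = E i)
    (h' : ∀ i, ∃ j, c j = c i ∧ E j = E' i) : colorRows c E = colorRows c E' := by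
  have key : ∀ (E E' : Fin n → Bool) (b : Bool), (∀ i, ∃ j, c j = c i ∧ E' j = E i) →
      (univ.filter fun i => E i = b).image c ⊆ (univ.filter fun i => E' i = b).image c := by
    intro E E' b h x hx
    simp only [mem_image, mem_filter, mem_univ, true_and] at hx ⊢
    obtain ⟨i, rfl, rfl⟩ := hx
    obtain ⟨j, hj, hj'⟩ := h i
    exact ⟨j, hj', hj⟩
  exact Prod.ext ((key E E' true h).antisymm (key E' E true h'))
    ((key E E' false h).antisymm (key E' E false h'))

lemma exists_eq_of_colorRows_eq {E E' : Fin n → Bool} (h : colorRows c E = colorRows c E')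
    (i : Fin n) : ∃ j, c j = c i ∧ E' j = E i := by
  cases hb : E i
  · have : c i ∈ (colorRows c E).2 := mem_image_of_mem _ (by simp [hb])
    rw [h] at this
    simpa [colorRows, and_comm] using this
  · have : c i ∈ (colorRows c E).1 := mem_image_of_mem _ (by simp [hb])
    rw [h] at this
    simpa [colorRows, and_comm] using this

lemma exists_alternating_eq {δ δ' : Quotient (idxSetoid n C D) → Bool}
    (h : ∀ Q, ¬ degenClass n C D Q → δ Q = δ' Q) (i : Fin n) :
    ∃ j : Fin n, C j = C i ∧ D j = D i ∧ alternating δ' j = alternating δ i := by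
  by_cases hdeg : degenClass n C D (Quotient.mk _ i)
  · by_cases hEi : alternating δ' i = alternating δ i
    · exact ⟨i, rfl, rfl, hEi⟩
    · obtain ⟨p, q, hpq, hC, hD, -, hall⟩ := hdeg
      have hne := alternating_ne (δ := δ') (show linkRel n C D p q from ⟨hpq, Or.inl hC⟩)
      rcases hall i rfl with rfl | rfl
      · refine ⟨q, hC.symm, hD.symm, ?_⟩
        revert hne hEi
        cases alternating δ' i <;> cases alternating δ' q <;> cases alternating δ i <;> simp
      · refine ⟨p, hC, hD, ?_⟩
        revert hne hEi
        cases alternating δ' i <;> cases alternating δ' p <;> cases alternating δ i <;> simp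
  · exact ⟨i, rfl, rfl, by unfold alternating; rw [h _ hdeg]⟩

lemma eq_of_colorRows_eq {δ δ' : Quotient (idxSetoid n C D) → Bool}
    (hc : Monotone fun i : Fin n => C i) (hd : Monotone fun i : Fin n => D i)
    (hc' : ClassStrictMono (fun i : Fin n => C i) (alternating δ))
    (hd' : ClassStrictMono (fun i : Fin n => D i) (alternating δ))
    (h1 : colorRows (fun i : Fin n => C i) (alternating δ) =
      colorRows (fun i : Fin n => C i) (alternating δ'))
    (h2 : colorRows (fun i : Fin n => D i) (alternating δ) =
      colorRows (fun i : Fin n => D i) (alternating δ'))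
    {Q : Quotient (idxSetoid n C D)} (hQ : ¬ degenClass n C D Q) : δ Q = δ' Q := by
  classical
  by_contra hne
  have hdiff : ∀ i, Quotient.mk (idxSetoid n C D) i = Q →
      alternating δ i ≠ alternating δ' i := by
    rintro i rfl
    unfold alternating
    simpa using hne
  obtain ⟨m, hm, hmax⟩ : ∃ m, Quotient.mk (idxSetoid n C D) m = Q ∧
      ∀ i, Quotient.mk (idxSetoid n C D) i = Q → i ≤ m := by
    have hS : (univ.filter fun i => Quotient.mk (idxSetoid n C D) i = Q).Nonempty := by
      obtain ⟨i, hi⟩ := Quotient.exists_rep Q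
      exact ⟨i, by simpa using hi⟩
    refine ⟨_, (mem_filter.1 (max'_mem _ hS)).2, fun i hi => le_max' _ _ (by simpa using hi)⟩
  have pred : ∀ (f : ℕ → ℕ), (Monotone fun i : Fin n => f i) →
      (∀ i j : Fin n, (j : ℕ) = i + 1 → f i = f j → linkRel n C D i j) →
      colorRows (fun i : Fin n => f i) (alternating δ) =
        colorRows (fun i : Fin n => f i) (alternating δ') → 0 < (m : ℕ) ∧ f (m - 1 : ℕ) = f m := by
    intro f hf hlink heq
    obtain ⟨j, hj, hjE⟩ := exists_eq_of_colorRows_eq heq m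
    have hjm : j ≠ m := by
      rintro rfl
      exact hdiff j hm hjE.symm
    rcases lt_or_gt_of_ne hjm with hlt | hlt
    · have hlt' := Fin.lt_def.1 hlt
      refine ⟨by omega, le_antisymm ?_ ?_⟩
      · exact hf (show (⟨m - 1, by omega⟩ : Fin n) ≤ m from Fin.le_def.2 (by simp))
      · rw [← hj]
        exact hf (show j ≤ (⟨m - 1, by omega⟩ : Fin n) from Fin.le_def.2 (by simp; omega))
    · have hlt' := Fin.lt_def.1 hlt
      let k : Fin n := ⟨m + 1, by omega⟩
      have hk := eq_succ_of_eq (c := fun i : Fin n => f i) hf (k := k) hlt rfl hj.symm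
      have := hmax k ((linkRel_mk_eq (hlink m k rfl hk)).symm.trans hm)
      exact absurd (Fin.le_def.1 this) (by simp [k])
  obtain ⟨hm0, hCm⟩ := pred C hc (fun i j hij h => ⟨hij, Or.inl h⟩) h1
  obtain ⟨-, hDm⟩ := pred D hd (fun i j hij h => ⟨hij, Or.inr h⟩) h2
  let p : Fin n := ⟨m - 1, by omega⟩
  have hpm : (m : ℕ) = p + 1 := by simp only [p]; omega
  have hp : Quotient.mk (idxSetoid n C D) p = Q :=
    (linkRel_mk_eq ⟨hpm, Or.inl hCm⟩).trans hm
  refine hQ ⟨p, m, hpm, hCm, hDm, hp.symm, fun x hx => ?_⟩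
  have hinv : ∀ x y : Fin n, Relation.EqvGen (linkRel n C D) x y → (p ≤ x ↔ p ≤ y) := by
    intro x y hxy
    induction hxy with
    | rel x y hr =>
      have hr1 := hr.1
      refine ⟨fun h => h.trans (Fin.le_def.2 (by omega)), fun h => ?_⟩
      by_contra hlt
      have hxp : x < p := not_le.1 hlt
      obtain rfl : y = p := Fin.ext (by
        have := Fin.le_def.1 h; have := Fin.lt_def.1 hxp; omega)
      have hpm' : p < m := Fin.lt_def.2 (by omega)
      exact hr.2.elim (fun h => hc'.not_three hxp hpm' h hCm)
        fun h => hd'.not_three hxp hpm' h hDm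
    | refl x => rfl
    | symm x y _ ih => exact ih.symm
    | trans x y z _ _ ih1 ih2 => exact ih1.trans ih2
  have hxm : x ≤ m := hmax x hx
  have hpx : p ≤ x := (hinv p x (Quotient.exact (hp.trans hx.symm))).1 le_rfl
  rcases hxm.eq_or_lt with h | h
  · exact Or.inr h
  · refine Or.inl (Fin.ext ?_)
    have := Fin.lt_def.1 h; have := Fin.le_def.1 hpx; omega

lemma ncard_minimalPairs (hc : Monotone fun i : Fin n => C i) (hd : Monotone fun i : Fin n => D i)
    (hc' : ∃ E, ClassStrictMono (fun i : Fin n => C i) E)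
    (hd' : ∃ E, ClassStrictMono (fun i : Fin n => D i) E) :
    (minimalPairs (fun i : Fin n => C i) fun i : Fin n => D i).ncard = 2 ^ ellCount n C D := by
  classical
  let ext (g : {Q : Quotient (idxSetoid n C D) // ¬ degenClass n C D Q} → Bool) :
      Quotient (idxSetoid n C D) → Bool :=
    fun Q => if h : degenClass n C D Q then false else g ⟨Q, h⟩
  let pair (δ : Quotient (idxSetoid n C D) → Bool) : BPair × BPair :=
    (colorRows (fun i : Fin n => C i) (alternating δ),
      colorRows (fun i : Fin n => D i) (alternating δ))
  have hvalid (δ : Quotient (idxSetoid n C D) → Bool) :=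
    (classStrictMono_and_iff hc hd hc' hd').2 ⟨δ, rfl⟩
  have hpair : ∀ δ δ' : Quotient (idxSetoid n C D) → Bool,
      pair δ = pair δ' ↔ ∀ Q, ¬ degenClass n C D Q → δ Q = δ' Q := by
    intro δ δ'
    constructor
    · intro h Q hQ
      exact eq_of_colorRows_eq hc hd (hvalid δ).1 (hvalid δ).2 (congrArg Prod.fst h)
        (congrArg Prod.snd h) hQ
    · intro h
      have e1 := exists_alternating_eq h
      have e2 := exists_alternating_eq fun Q hQ => (h Q hQ).symm
      refine Prod.ext (colorRows_eq_of_forall (fun i => ?_) fun i => ?_)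
        (colorRows_eq_of_forall (fun i => ?_) fun i => ?_)
      · obtain ⟨j, h1, h2, h3⟩ := e1 i
        exact ⟨j, h1, h3⟩
      · obtain ⟨j, h1, h2, h3⟩ := e2 i
        exact ⟨j, h1, h3⟩
      · obtain ⟨j, h1, h2, h3⟩ := e1 i
        exact ⟨j, h2, h3⟩
      · obtain ⟨j, h1, h2, h3⟩ := e2 i
        exact ⟨j, h2, h3⟩
  have hrange : (minimalPairs (fun i : Fin n => C i) fun i : Fin n => D i) =
      Set.range fun g => pair (ext g) := by
    ext R
    rw [mem_minimalPairs_iff hc hd, Set.mem_range]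
    constructor
    · rintro ⟨E, h1, h2, rfl⟩
      obtain ⟨δ, rfl⟩ := (classStrictMono_and_iff hc hd hc' hd').1 ⟨h1, h2⟩
      exact ⟨fun Q => δ Q, (hpair _ δ).2 fun Q hQ => by simp [ext, hQ]⟩
    · rintro ⟨g, rfl⟩
      exact ⟨_, (hvalid (ext g)).1, (hvalid (ext g)).2, rfl⟩
  have hinj : Function.Injective fun g => pair (ext g) := by
    intro g g' h
    funext ⟨Q, hQ⟩
    simpa [ext, hQ] using (hpair _ _).1 h Q hQ
  rw [hrange, ← Nat.card_coe_set_eq, Nat.card_range_of_injective hinj, Nat.card_fun,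
    Nat.card_eq_fintype_card, Fintype.card_bool, ellCount]

end Counting

section Halving

/-- Exchange the two rows of both components. -/
def swapRows (R : BPair × BPair) : BPair × BPair := (R.1.swap, R.2.swap)

lemma pEntries_swap (P : BPair) : pEntries P.swap = pEntries P := add_comm _ _

lemma entries_congr {P Q : BPair} (h : pEntries P = pEntries Q) : entries P = entries Q :=
  congrArg (Multiset.sort · (· ≤ ·)) h

lemma pDefect_swap (P : BPair) : pDefect P.swap = -pDefect P := by
  simp [pDefect]

lemma swapRows_mem {R : BPair × BPair} (h : R ∈ minimalPairs c d) :
    swapRows R ∈ minimalPairs c d := by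
  obtain ⟨h1, h2, h3, h4, h5⟩ := h
  refine ⟨(pEntries_swap _).trans h1, (pEntries_swap _).trans h2, h4, h3, ?_⟩
  have e : oplus R.1.swap R.2.swap = (oplus R.1 R.2).swap := rfl
  simp only [swapRows, aFun, bX, e, entries_congr (pEntries_swap _)] at h5 ⊢
  exact h5

lemma two_mul_ncard_pos (hn : Odd n) (hfin : (minimalPairs c d).Finite) :
    2 * {R ∈ minimalPairs c d | 0 < pDefect R.1}.ncard = (minimalPairs c d).ncard := by
  have hneg : {R ∈ minimalPairs c d | ¬ 0 < pDefect R.1} =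
      swapRows '' {R ∈ minimalPairs c d | 0 < pDefect R.1} := by
    ext R
    constructor
    · rintro ⟨hR, hd⟩
      refine ⟨swapRows R, ⟨swapRows_mem hR, ?_⟩, rfl⟩
      have hcard : R.1.1.card + R.1.2.card = n := by rw [← card_pEntries, hR.1]; simp
      obtain ⟨m, rfl⟩ := hn
      rw [swapRows, pDefect_swap]
      unfold pDefect at hd ⊢
      omega
    · rintro ⟨R, ⟨hR, hd⟩, rfl⟩
      refine ⟨swapRows_mem hR, ?_⟩
      rw [swapRows, pDefect_swap]
      omega
  have hinj : Function.Injective swapRows := fun R R' h => congrArg swapRows h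
  have hunion : minimalPairs c d = {R ∈ minimalPairs c d | 0 < pDefect R.1} ∪
      {R ∈ minimalPairs c d | ¬ 0 < pDefect R.1} := by
    ext R
    simp only [Set.mem_union, Set.mem_ofPred_eq]
    tauto
  have hdisj : Disjoint {R ∈ minimalPairs c d | 0 < pDefect R.1}
      {R ∈ minimalPairs c d | ¬ 0 < pDefect R.1} :=
    Set.disjoint_left.2 fun R h h' => h'.2 h.2
  conv_rhs => rw [hunion, Set.ncard_union_eq hdisj (hfin.subset fun R h => h.1)
    (hfin.subset fun R h => h.1), hneg, Set.ncard_image_of_injective _ hinj]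
  ring

end Halving

section Shift

lemma mem_bShift {k x : ℕ} {B : Finset ℕ} : x ∈ bShift k B ↔ x < k ∨ k ≤ x ∧ x - k ∈ B := by
  simp only [bShift, mem_union, mem_range, mem_image]
  refine or_congr_right ⟨?_, fun ⟨h, hx⟩ => ⟨x - k, hx, by omega⟩⟩
  rintro ⟨b, hb, rfl⟩
  simpa using hb

lemma bShift_zero (B : Finset ℕ) : bShift 0 B = B := by ext x; simp [mem_bShift]

lemma bShift_add (s t : ℕ) (B : Finset ℕ) : bShift (s + t) B = bShift t (bShift s B) := by
  ext x
  simp only [mem_bShift, Nat.sub_sub, add_comm t s]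
  constructor
  · rintro (h | ⟨h, hx⟩)
    · by_cases x < t
      · exact Or.inl ‹_›
      · exact Or.inr ⟨by omega, Or.inl (by omega)⟩
    · exact Or.inr ⟨by omega, Or.inr ⟨by omega, hx⟩⟩
  · rintro (h | ⟨h, h' | ⟨h', hx⟩⟩)
    · exact Or.inl (by omega)
    · exact Or.inl (by omega)
    · exact Or.inr ⟨by omega, hx⟩

lemma bShift_one (B : Finset ℕ) : bShift 1 B = insert 0 (B.image (· + 1)) := by
  simp [bShift]

lemma bShift_one_val (B : Finset ℕ) : (bShift 1 B).val = 0 ::ₘ B.val.map (· + 1) := by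
  rw [bShift_one, insert_val_of_notMem (by simp),
    image_val_of_injOn (add_left_injective 1).injOn]

lemma bShift_injective (k : ℕ) : Function.Injective (bShift k) := by
  intro A B h
  ext x
  have := congrArg (x + k ∈ ·) h
  simpa [mem_bShift] using this

lemma card_bShift (k : ℕ) (B : Finset ℕ) : (bShift k B).card = B.card + k := by
  induction k with
  | zero => rw [bShift_zero]; rfl
  | succ k ih =>
    rw [bShift_add, ← card_val, bShift_one_val, Multiset.card_cons, Multiset.card_map, card_val, ih,
      add_assoc]

lemma pShift_zero (P : BPair) : pShift 0 P = P := by simp [pShift, bShift_zero]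

lemma pShift_add (s t : ℕ) (P : BPair) : pShift (s + t) P = pShift t (pShift s P) := by
  simp [pShift, bShift_add]

lemma pShift_injective (k : ℕ) : Function.Injective (pShift k) := fun _ _ h =>
  Prod.ext (bShift_injective k (congrArg Prod.fst h)) (bShift_injective k (congrArg Prod.snd h))

lemma pDefect_pShift (k : ℕ) (P : BPair) : pDefect (pShift k P) = pDefect P := by
  simp [pDefect, pShift, card_bShift]

lemma not_reduced_pShift {k : ℕ} (hk : 0 < k) (P : BPair) : ¬ reduced (pShift k P) := by
  simp [reduced, pShift, mem_bShift, hk]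

lemma eq_of_pShift_eq {j k : ℕ} {P Q : BPair} (hP : reduced P) (hQ : reduced Q)
    (h : pShift j P = pShift k Q) : P = Q := by
  wlog hjk : j ≤ k generalizing j k P Q
  · exact (this hQ hP h.symm (by omega)).symm
  obtain ⟨t, rfl⟩ := Nat.exists_eq_add_of_le hjk
  rw [add_comm, pShift_add] at h
  have h' := pShift_injective _ h
  rcases Nat.eq_zero_or_pos t with rfl | ht
  · rw [h', pShift_zero]
  · exact absurd (h' ▸ hP) (not_reduced_pShift ht Q)

lemma exists_eq_pShift_one {P : BPair} (h : ¬ reduced P) : ∃ Q, P = pShift 1 Q := by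
  rw [reduced, not_not] at h
  have key : ∀ A : Finset ℕ, 0 ∈ A → A = bShift 1 ((A.erase 0).image (· - 1)) := by
    intro A hA
    ext x
    rcases x with _ | x
    · simp [mem_bShift, hA]
    · simp only [mem_bShift, mem_image, mem_erase]
      constructor
      · intro hx
        exact Or.inr ⟨by omega, x + 1, ⟨by omega, hx⟩, rfl⟩
      · rintro (h | ⟨-, y, ⟨hy, hyA⟩, hyx⟩)
        · omega
        · rwa [show x + 1 = y by omega]
  exact ⟨(_, _), Prod.ext (key _ h.1) (key _ h.2)⟩

lemma exists_reduced (P : BPair) : ∃ Q j, reduced Q ∧ P = pShift j Q := by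
  induction hm : P.1.card generalizing P with
  | zero =>
    refine ⟨P, 0, ?_, (pShift_zero P).symm⟩
    rw [card_eq_zero] at hm
    simp [reduced, hm]
  | succ m ih =>
    by_cases hP : reduced P
    · exact ⟨P, 0, hP, (pShift_zero P).symm⟩
    · obtain ⟨Q, rfl⟩ := exists_eq_pShift_one hP
      have hQ : Q.1.card = m := by
        simpa [pShift, card_bShift] using hm
      obtain ⟨Q', j, hQ', rfl⟩ := ih Q hQ
      exact ⟨Q', j + 1, hQ', (pShift_add _ _ _).symm⟩

lemma pEntries_pShift_one (P : BPair) :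
    pEntries (pShift 1 P) = 0 ::ₘ 0 ::ₘ (pEntries P).map (· + 1) := by
  simp [pEntries, pShift, bShift_one_val, Multiset.map_add]

lemma card_pEntries_pShift (j : ℕ) (P : BPair) :
    (pEntries (pShift j P)).card = (pEntries P).card + 2 * j := by
  rw [card_pEntries, card_pEntries]
  simp only [pShift, card_bShift]
  ring

lemma entries_of_cons_cons {P Q : BPair} (r : ℕ)
    (h : pEntries Q = 0 ::ₘ 0 ::ₘ (pEntries P).map (· + r)) :
    entries Q = 0 :: 0 :: (entries P).map (· + r) := by
  have : entries Q = (pEntries Q).sort (· ≤ ·) := rfl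
  rw [this, h, Multiset.sort_cons _ _ _ (by simp), Multiset.sort_cons _ _ _ (by simp),
    ← Multiset.map_sort (r := (· ≤ ·)) _ _ _ (by simp)]
  rfl

lemma wsum_cons_cons (L : List ℕ) {ref : ℕ → ℕ} {r : ℕ} (h0 : ref 0 = 0) (h1 : ref 1 = 0)
    (h2 : ∀ j, ref (j + 2) = ref j + r) :
    wsum (0 :: 0 :: L.map (· + r)) ref = wsum L ref := by
  unfold wsum
  simp only [List.length_cons, List.length_map]
  rw [sum_range_succ', sum_range_succ']
  simp only [zero_add, List.getD_cons_succ, List.getD_cons_zero, h0, h1, sub_self, mul_zero,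
    add_zero]
  refine sum_congr rfl fun j hj => ?_
  rw [mem_range] at hj
  rw [List.getD_eq_getElem _ _ (by simpa using hj), List.getD_eq_getElem _ _ hj, List.getElem_map,
    show j + 1 + 1 = j + 2 from rfl, h2, show L.length + 1 + 1 - 1 - (j + 2) = L.length - 1 - j by
      omega]
  push_cast
  ring

lemma aFun_pShift_one (P : BPair) : aFun (pShift 1 P) = aFun P := by
  unfold aFun
  rw [entries_of_cons_cons 1 (pEntries_pShift_one P)]
  exact wsum_cons_cons _ rfl rfl fun j => by omega

lemma sort_bShift_one (A : Finset ℕ) : (bShift 1 A).sort = 0 :: A.sort.map (· + 1) := by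
  rw [← sort_val, bShift_one_val, Multiset.sort_cons _ _ _ (by simp),
    ← Multiset.map_sort (r := (· ≤ ·)) _ _ _ (by simp)]
  rfl

lemma nthEl_bShift_one_zero (A : Finset ℕ) : nthEl (bShift 1 A) 0 = 0 := by
  simp [nthEl, sort_bShift_one]

lemma nthEl_bShift_one_succ {A : Finset ℕ} {i : ℕ} (hi : i < A.card) :
    nthEl (bShift 1 A) (i + 1) = nthEl A i + 1 := by
  unfold nthEl
  rw [sort_bShift_one, List.getD_cons_succ, List.getD_eq_getElem _ _ (by simpa using hi),
    List.getD_eq_getElem _ _ (by simpa using hi), List.getElem_map]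

lemma addRows_bShift_one {A B : Finset ℕ} (h : A.card = B.card) :
    (addRows (bShift 1 A) (bShift 1 B)).val = 0 ::ₘ (addRows A B).val.map (· + 2) := by
  have e : addRows (bShift 1 A) (bShift 1 B) = insert 0 ((addRows A B).image (· + 2)) := by
    ext x
    simp only [addRows, card_bShift, mem_image, mem_range, mem_insert, exists_exists_and_eq_and]
    constructor
    · rintro ⟨i, hi, rfl⟩
      rcases i with _ | i
      · exact Or.inl (by simp [nthEl_bShift_one_zero])
      · have hi' : i < A.card := by omega
        refine Or.inr ⟨i, hi', ?_⟩
        rw [nthEl_bShift_one_succ hi', nthEl_bShift_one_succ (h ▸ hi')]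
        ring
    · rintro (rfl | ⟨i, hi, rfl⟩)
      · exact ⟨0, by omega, by simp [nthEl_bShift_one_zero]⟩
      · refine ⟨i + 1, by omega, ?_⟩
        rw [nthEl_bShift_one_succ hi, nthEl_bShift_one_succ (h ▸ hi)]
        ring
  rw [e, insert_val_of_notMem (by simp), image_val_of_injOn (add_left_injective 2).injOn]

lemma bX_oplus_pShift_one {P Q : BPair} (h1 : P.1.card = Q.1.card) (h2 : P.2.card = Q.2.card) :
    bX (oplus (pShift 1 P) (pShift 1 Q)) = bX (oplus P Q) := by
  unfold bX
  rw [entries_of_cons_cons (P := oplus P Q) 2]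
  · exact wsum_cons_cons _ rfl rfl fun j => by omega
  · simp [pEntries, oplus, pShift, addRows_bShift_one h1, addRows_bShift_one h2, Multiset.map_add]

/-- The condition of `minimalPair` for the given representatives. -/
def RepMinimal (P Q : BPair) : Prop :=
  P.1.card = Q.1.card ∧ P.2.card = Q.2.card ∧ aFun P + aFun Q = bX (oplus P Q)

lemma repMinimal_pShift_iff (t : ℕ) (P Q : BPair) :
    RepMinimal (pShift t P) (pShift t Q) ↔ RepMinimal P Q := by
  induction t with
  | zero => simp [pShift_zero]
  | succ t ih =>
    rw [← ih, pShift_add, pShift_add]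
    set P' := pShift t P
    set Q' := pShift t Q
    have e1 : (pShift 1 P').1.card = P'.1.card + 1 := card_bShift _ _
    have e2 : (pShift 1 P').2.card = P'.2.card + 1 := card_bShift _ _
    have e3 : (pShift 1 Q').1.card = Q'.1.card + 1 := card_bShift _ _
    have e4 : (pShift 1 Q').2.card = Q'.2.card + 1 := card_bShift _ _
    unfold RepMinimal
    rw [e1, e2, e3, e4, add_left_inj, add_left_inj]
    refine and_congr_right fun h1 => and_congr_right fun h2 => ?_
    rw [aFun_pShift_one, aFun_pShift_one, bX_oplus_pShift_one h1 h2]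

lemma exists_pShift_of_pEquiv {P Q : BPair} (hP : reduced P) (h : pEquiv P Q) :
    ∃ s, Q = pShift s P := by
  obtain ⟨s, h | h⟩ := h
  · exact ⟨s, h.symm⟩
  · obtain ⟨Q', j, hQ', rfl⟩ := exists_reduced Q
    rw [← pShift_add] at h
    have : P = Q' := eq_of_pShift_eq (j := 0) hP hQ' (by rw [pShift_zero, h])
    exact ⟨j, by rw [this]⟩

lemma minimalPair_iff {P Q : BPair} (hP : reduced P) (hQ : reduced Q) {i j : ℕ}
    (hcard : (pEntries (pShift i P)).card = (pEntries (pShift j Q)).card) :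
    minimalPair P Q ↔ RepMinimal (pShift i P) (pShift j Q) := by
  constructor
  · rintro ⟨P', Q', hPP', hQQ', h⟩
    obtain ⟨s, rfl⟩ := exists_pShift_of_pEquiv hP hPP'
    obtain ⟨t, rfl⟩ := exists_pShift_of_pEquiv hQ hQQ'
    have h' : RepMinimal (pShift s P) (pShift t Q) := h
    have h1 := h.1
    have h2 := h.2.1
    rw [card_pEntries_pShift, card_pEntries_pShift, card_pEntries, card_pEntries] at hcard
    simp only [pShift, card_bShift] at h1 h2
    rcases le_total s i with hsi | hsi
    · obtain ⟨r, rfl⟩ := Nat.exists_eq_add_of_le hsi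
      obtain rfl : j = t + r := by omega
      rw [pShift_add, pShift_add]
      exact (repMinimal_pShift_iff _ _ _).2 h'
    · obtain ⟨r, rfl⟩ := Nat.exists_eq_add_of_le hsi
      obtain rfl : t = j + r := by omega
      rw [pShift_add, pShift_add] at h'
      exact (repMinimal_pShift_iff _ _ _).1 h'
  · intro h
    exact ⟨_, _, ⟨i, Or.inl rfl⟩, ⟨j, Or.inl rfl⟩, h⟩

lemma union_inter_eq_iff {P Q : BPair} :
    (P.1 ∪ P.2 = Q.1 ∪ Q.2 ∧ P.1 ∩ P.2 = Q.1 ∩ Q.2) ↔ pEntries P = pEntries Q := by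
  have hsum : ∀ P : BPair, pEntries P = (P.1 ∪ P.2).val + (P.1 ∩ P.2).val := fun P => by
    rw [union_val, inter_val, Multiset.union_add_inter]
    rfl
  have hunion : ∀ P : BPair, P.1 ∪ P.2 = (pEntries P).toFinset := fun P => by
    simp [pEntries, Multiset.toFinset_add]
  constructor
  · rintro ⟨h1, h2⟩
    rw [hsum, hsum, h1, h2]
  · intro h
    have h1 : P.1 ∪ P.2 = Q.1 ∪ Q.2 := by rw [hunion, hunion, h]
    refine ⟨h1, ?_⟩
    rw [hsum, hsum, h1, add_right_inj] at h
    exact val_injective h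

lemma pSimilar_iff {P Q : BPair} (hP : reduced P) :
    pSimilar P Q ↔ ∃ j, pEntries (pShift j P) = pEntries Q := by
  unfold pSimilar
  simp only [union_inter_eq_iff]
  constructor
  · rintro ⟨j, k, h⟩
    induction k generalizing j with
    | zero => exact ⟨j, by rw [h, pShift_zero]⟩
    | succ k ih =>
      rcases j with _ | j
      · rw [pShift_zero, pShift_add, pEntries_pShift_one] at h
        have h0 := congrArg (Multiset.count 0) h
        rw [pEntries, Multiset.count_add, Multiset.count_cons_self, Multiset.count_cons_self] at h0
        have hP1 := Multiset.nodup_iff_count_le_one.1 P.1.nodup 0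
        have hP2 := Multiset.nodup_iff_count_le_one.1 P.2.nodup 0
        exact absurd ⟨Multiset.one_le_count_iff_mem.1 (by omega),
          Multiset.one_le_count_iff_mem.1 (by omega)⟩ hP
      · rw [pShift_add, pShift_add, pEntries_pShift_one, pEntries_pShift_one,
          Multiset.cons_inj_right, Multiset.cons_inj_right] at h
        exact ih j (Multiset.map_injective (add_left_injective 1) h)
  · rintro ⟨j, h⟩
    exact ⟨j, 0, by rw [h, pShift_zero]⟩

end Shift

lemma entries_getD {P : BPair} (h : P.1.card + P.2.card = n) :
    (Monotone fun i : Fin n => (entries P).getD i 0) ∧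
      pEntries P = univ.val.map fun i : Fin n => (entries P).getD i 0 := by
  have hl : (entries P).length = n := by
    rw [entries, Multiset.length_sort, ← h, ← card_pEntries]
    rfl
  have e : List.ofFn (fun i : Fin n => (entries P).getD i 0) = entries P := by
    refine List.ext_getElem (by simp [hl]) fun i h1 h2 => ?_
    rw [List.getElem_ofFn, List.getD_eq_getElem _ _ h2]
  constructor
  · rw [← List.sortedLE_ofFn_iff, e]
    exact (Multiset.pairwise_sort _ _).sortedLE
  · rw [Fin.univ_val_map, e, entries, Multiset.sort_eq]
    rfl

/-- Shift both reduced components so that they have `n` entries. -/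
def shiftTo (n : ℕ) (R : BPair × BPair) : BPair × BPair :=
  (pShift ((n - (pEntries R.1).card) / 2) R.1, pShift ((n - (pEntries R.2).card) / 2) R.2)

lemma shiftTo_pShift {P Q : BPair} {i j : ℕ} (hP : (pEntries (pShift i P)).card = n)
    (hQ : (pEntries (pShift j Q)).card = n) :
    shiftTo n (P, Q) = (pShift i P, pShift j Q) := by
  rw [card_pEntries_pShift] at hP hQ
  simp only [shiftTo]
  congr 2 <;> omega

lemma shiftTo_image {L X : BPair} (hL : pEntries L = univ.val.map c)
    (hX : pEntries X = univ.val.map d) :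
    shiftTo n '' {P : BPair × BPair |
        reduced P.1 ∧ reduced P.2 ∧ pSimilar P.1 L ∧ pSimilar P.2 X ∧
        0 < pDefect P.1 ∧ 0 < pDefect P.2 ∧ pDefect P.1 = pDefect P.2 ∧
        minimalPair P.1 P.2} = {R ∈ minimalPairs c d | 0 < pDefect R.1} := by
  ext ⟨R, R'⟩
  constructor
  · rintro ⟨⟨P, Q⟩, ⟨hP, hQ, hPL, hQX, hdP, -, -, hmin⟩, hR⟩
    obtain ⟨i, hi⟩ := (pSimilar_iff hP).1 hPL
    obtain ⟨j, hj⟩ := (pSimilar_iff hQ).1 hQX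
    have hPn : (pEntries (pShift i P)).card = n := by rw [hi, hL]; simp
    have hQn : (pEntries (pShift j Q)).card = n := by rw [hj, hX]; simp
    rw [shiftTo_pShift hPn hQn] at hR
    obtain ⟨rfl, rfl⟩ := Prod.mk.inj hR
    exact ⟨⟨hi.trans hL, hj.trans hX, (minimalPair_iff hP hQ (hPn.trans hQn.symm)).1 hmin⟩,
      by rwa [pDefect_pShift]⟩
  · rintro ⟨⟨h1, h2, hmin⟩, hpos⟩
    obtain ⟨P, i, hP, rfl⟩ := exists_reduced R
    obtain ⟨Q, j, hQ, rfl⟩ := exists_reduced R'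
    have hPn : (pEntries (pShift i P)).card = n := by rw [h1]; simp
    have hQn : (pEntries (pShift j Q)).card = n := by rw [h2]; simp
    have hd : pDefect P = pDefect Q := by
      rw [← pDefect_pShift i P, ← pDefect_pShift j Q, pDefect, pDefect, hmin.1, hmin.2.1]
    rw [pDefect_pShift] at hpos
    exact ⟨(P, Q), ⟨hP, hQ, (pSimilar_iff hP).2 ⟨i, h1.trans hL.symm⟩,
      (pSimilar_iff hQ).2 ⟨j, h2.trans hX.symm⟩, hpos, hd ▸ hpos, hd,
      (minimalPair_iff hP hQ (hPn.trans hQn.symm)).2 hmin⟩, shiftTo_pShift hPn hQn⟩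

lemma shiftTo_injOn : Set.InjOn (shiftTo n) {R | reduced R.1 ∧ reduced R.2} := fun _ h _ h' he =>
  Prod.ext (eq_of_pShift_eq h.1 h'.1 (congrArg Prod.fst he))
    (eq_of_pShift_eq h.2 h'.2 (congrArg Prod.snd he))

end MinimalPairs

/-- type B: cardinality of the set of minimizing pairs: the
number of pairs of symbols `(Λ,Ξ) ∈ V × W` (counted via their unique reduced
representatives) with equal positive defects and `a(Λ)+a(Ξ) = b(Λ⊕Ξ)` equals
`2^{ℓ-1}`, where `ℓ` is the number of non-degenerate equivalence classes of
indices for the chosen representatives `(Λ₀,Ξ₀)`. -/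
theorem statement_18 (a b k : ℕ) (L0 X0 : BPair)
    (hra : pRank L0 = a) (hrb : pRank X0 = b)
    (hodd : Odd (pDefect L0)) (hpos : 0 < pDefect L0)
    (hdd : pDefect L0 = pDefect X0)
    (hz1 : 0 ∈ L0.1) (hz2 : 0 ∈ L0.2) (hz3 : 0 ∈ X0.1) (hz4 : 0 ∈ X0.2)
    (hm1 : L0.1.card + L0.2.card = 2 * k + 1)
    (hm2 : X0.1.card + X0.2.card = 2 * k + 1) :
    {P : BPair × BPair |
        reduced P.1 ∧ reduced P.2 ∧ pSimilar P.1 L0 ∧ pSimilar P.2 X0 ∧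
        0 < pDefect P.1 ∧ 0 < pDefect P.2 ∧ pDefect P.1 = pDefect P.2 ∧
        minimalPair P.1 P.2}.ncard =
      2 ^ (ellCount (2 * k + 1)
            (fun j => (entries L0).getD j 0)
            (fun j => (entries X0).getD j 0) - 1) := by
  obtain ⟨hc, hL⟩ := entries_getD hm1
  obtain ⟨hd, hX⟩ := entries_getD hm2
  have hcount := ncard_minimalPairs (C := fun j => (entries L0).getD j 0)
    (D := fun j => (entries X0).getD j 0) hc hd (exists_classStrictMono hc hL)
    (exists_classStrictMono hd hX)
  have hhalf := two_mul_ncard_pos ⟨k, rfl⟩ (Set.finite_of_ncard_ne_zero (by rw [hcount]; positivity))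
  rw [hcount, ← shiftTo_image hL hX, Set.InjOn.ncard_image] at hhalf
  · rcases hl : ellCount (2 * k + 1) (fun j => (entries L0).getD j 0)
      (fun j => (entries X0).getD j 0) with _ | l
    · rw [hl] at hhalf
      omega
    · rw [hl, pow_succ] at hhalf
      rw [Nat.add_sub_cancel]
      omega
  · exact shiftTo_injOn.mono fun R h => And.intro h.1 h.2.1

end CSpaper
end
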